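/- arXiv:0704.3916 — 2 statements merged into one kernel-verified Lean document; each statement's English description precedes it below -/
import Mathlib

section
/- Let (X, d, μ) be a doubling metric measure space, 1 < p < q < ∞, and let f ∈ L^q_loc(X) be non-negative and satisfy the reverse Hölder inequality with exponent p and constant c. Then for every ball B₀ in X, with α = ess inf_{B₀} Mf (Mf the maximal function restricted to 100B₀), one has ∫_{B₀ ∩ {Mf > α}} f^q dμ ≤ c' α^q μ(100B₀ ∩ {Mf > α}) + c' ((q − p)/q) ∫_{100B₀} (Mf)^q dμ, where c' depends only on p, the doubling constant and c. -/
open MeasureTheory Metric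
open scoped NNReal ENNReal

/-- `μ` is a doubling measure with doubling constant `c_d`. -/
def IsDoublingMeasure {X : Type*} [MetricSpace X] [MeasurableSpace X]
    (μ : Measure X) (c_d : ℝ≥0) : Prop :=
  ∀ (x : X) (r : ℝ), 0 < r → μ (ball x (2 * r)) ≤ (c_d : ℝ≥0∞) * μ (ball x r)

/-- `f` satisfies the reverse Hölder inequality with exponent `p` and constant `c`. -/
def ReverseHolder {X : Type*} [MetricSpace X] [MeasurableSpace X]
    (μ : Measure X) (p c : ℝ) (f : X → ℝ) : Prop :=
  ∀ (x : X) (r : ℝ), 0 < r →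
    IntegrableOn (fun y => f y ^ p) (ball x r) μ ∧
    (⨍ y in ball x r, f y ^ p ∂μ) ^ (1 / p) ≤ c * ⨍ y in ball x r, f y ∂μ

/-- The Hardy–Littlewood maximal function of `f` restricted to the ball `100B₀`, where
`B₀ = B(x₀, r₀)`:  `Mf(y) = sup { ⨍_B |f| dμ : B ∋ y, B ⊆ 100B₀ }`. -/
noncomputable def restrictedMaximal {X : Type*} [MetricSpace X] [MeasurableSpace X]
    (μ : Measure X) (f : X → ℝ) (x₀ : X) (r₀ : ℝ) (y : X) : ℝ :=
  sSup ((fun B : X × ℝ => ⨍ z in ball B.1 B.2, |f z| ∂μ) ''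
    {B : X × ℝ | 0 < B.2 ∧ y ∈ ball B.1 B.2 ∧ ball B.1 B.2 ⊆ ball x₀ (100 * r₀)})

namespace RHM

set_option linter.unusedSectionVars false

variable {X : Type*} [MetricSpace X] [MeasurableSpace X] [BorelSpace X] {μ : Measure X}

lemma sigmaFinite_of_bdd [Nonempty X]
    (hbdd : ∀ s : Set X, Bornology.IsBounded s → μ s < ⊤) : SigmaFinite μ := by
  obtain ⟨x₀⟩ := ‹Nonempty X›
  refine ⟨⟨⟨fun n : ℕ => ball x₀ n, fun _ => trivial, fun n => hbdd _ isBounded_ball, ?_⟩⟩⟩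
  exact iUnion_ball_nat x₀

lemma secondCountable_of_bdd [SigmaFinite μ]
    (hopen : ∀ U : Set X, IsOpen U → U.Nonempty → 0 < μ U) :
    SecondCountableTopology X := by
  apply Metric.secondCountable_of_almost_dense_set
  intro ε hε
  obtain ⟨u, -, hd, hc⟩ := Vitali.exists_disjoint_subfamily_covering_enlargement_closedBall
    (Set.univ : Set X) (fun x => x) (fun _ => ε / 5) (ε / 5) (fun _ _ => le_rfl) 5 (by norm_num)
  refine ⟨u, ?_, fun x => ?_⟩
  · have h := Measure.countable_meas_pos_of_disjoint_iUnion (μ := μ)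
      (As := fun a : u => closedBall (a : X) (ε / 5)) (fun i => measurableSet_closedBall)
      (fun a b hab => hd a.2 b.2 (fun h => hab (Subtype.ext h)))
    have h2 : {i : u | 0 < μ (closedBall (i : X) (ε / 5))} = Set.univ := by
      ext i
      simp only [Set.mem_ofPred_eq, Set.mem_univ, iff_true]
      refine lt_of_lt_of_le (hopen (ball (i : X) (ε / 5)) isOpen_ball
        ⟨i, mem_ball_self (by positivity)⟩) (measure_mono ball_subset_closedBall)
    rw [h2] at h
    exact Set.countable_coe_iff.1 (Set.countable_univ_iff.1 h)
  · obtain ⟨b, hb, hs⟩ := hc x trivial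
    refine ⟨b, hb, ?_⟩
    have := hs (mem_closedBall_self (by positivity))
    rw [mem_closedBall] at this
    linarith

lemma doubling8 {c_d : ℝ≥0} (hdb : IsDoublingMeasure μ c_d) (x : X) (r : ℝ) (hr : 0 < r) :
    μ (ball x (8 * r)) ≤ (c_d : ℝ≥0∞) ^ 3 * μ (ball x r) := by
  have h1 := hdb x r hr
  have h2 := hdb x (2 * r) (by positivity)
  have h3 := hdb x (2 * (2 * r)) (by positivity)
  calc μ (ball x (8 * r)) = μ (ball x (2 * (2 * (2 * r)))) := by ring_nf
    _ ≤ c_d * (c_d * (c_d * μ (ball x r))) := by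
      refine h3.trans ?_
      gcongr
      refine h2.trans ?_
      gcongr
    _ = _ := by ring

/-- The `ℝ≥0∞`-valued restricted maximal function. -/
noncomputable def N (μ : Measure X) (g : X → ℝ≥0∞) (x₀ : X) (R : ℝ) (y : X) : ℝ≥0∞ :=
  sSup ((fun B : X × ℝ => ⨍⁻ z in ball B.1 B.2, g z ∂μ) ''
    {B : X × ℝ | 0 < B.2 ∧ y ∈ ball B.1 B.2 ∧ ball B.1 B.2 ⊆ ball x₀ R})

lemma lt_N {g : X → ℝ≥0∞} {x₀ : X} {R : ℝ} {y : X} {a : ℝ≥0∞} :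
    a < N μ g x₀ R y ↔ ∃ x r, 0 < r ∧ y ∈ ball x r ∧ ball x r ⊆ ball x₀ R ∧
      a < ⨍⁻ z in ball x r, g z ∂μ := by
  unfold N
  rw [lt_sSup_iff]
  constructor
  · rintro ⟨_, ⟨⟨x, r⟩, ⟨h1, h2, h3⟩, rfl⟩, h⟩
    exact ⟨x, r, h1, h2, h3, h⟩
  · rintro ⟨x, r, h1, h2, h3, h⟩
    exact ⟨_, ⟨⟨x, r⟩, ⟨h1, h2, h3⟩, rfl⟩, h⟩

lemma le_N {g : X → ℝ≥0∞} {x₀ : X} {R : ℝ} {y : X} {x : X} {r : ℝ} (h1 : 0 < r)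
    (h2 : y ∈ ball x r) (h3 : ball x r ⊆ ball x₀ R) :
    ⨍⁻ z in ball x r, g z ∂μ ≤ N μ g x₀ R y :=
  le_sSup ⟨⟨x, r⟩, ⟨h1, h2, h3⟩, rfl⟩

lemma isOpen_lt_N (g : X → ℝ≥0∞) (x₀ : X) (R : ℝ) (a : ℝ≥0∞) :
    IsOpen {y | a < N μ g x₀ R y} := by
  rw [isOpen_iff_mem_nhds]
  intro y hy
  obtain ⟨x, r, h1, h2, h3, h⟩ := lt_N.1 hy
  filter_upwards [isOpen_ball.mem_nhds h2] with z hz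
  exact lt_N.2 ⟨x, r, h1, hz, h3, h⟩

lemma measurable_N (g : X → ℝ≥0∞) (x₀ : X) (R : ℝ) : Measurable (N μ g x₀ R) :=
  measurable_of_Ioi fun a => (isOpen_lt_N g x₀ R a).measurableSet

lemma lt_N_subset (g : X → ℝ≥0∞) (x₀ : X) (R : ℝ) (a : ℝ≥0∞) :
    {y | a < N μ g x₀ R y} ⊆ ball x₀ R := by
  intro y hy
  obtain ⟨x, r, h1, h2, h3, h⟩ := lt_N.1 hy
  exact h3 h2

/-- Weak type estimate. -/
lemma weak_type [SecondCountableTopology X] {c_d : ℝ≥0} (hdb : IsDoublingMeasure μ c_d)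
    (hopen : ∀ U : Set X, IsOpen U → U.Nonempty → 0 < μ U)
    (hbdd : ∀ s : Set X, Bornology.IsBounded s → μ s < ⊤)
    (g : X → ℝ≥0∞) (x₀ : X) (R : ℝ) (a : ℝ≥0∞) :
    a * μ {y | a < N μ g x₀ R y} ≤ (c_d : ℝ≥0∞) ^ 3 * ∫⁻ z in ball x₀ R, g z ∂μ := by
  let t : Set (X × ℝ) := {B | 0 < B.2 ∧ B.2 ≤ 2 * R ∧ ball B.1 B.2 ⊆ ball x₀ R ∧
    a < ⨍⁻ z in ball B.1 B.2, g z ∂μ}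
  obtain ⟨u, hut, hd, hc⟩ := Vitali.exists_disjoint_subfamily_covering_enlargement_closedBall
    t (fun B => B.1) (fun B => B.2) (2 * R) (fun B hB => hB.2.1) 5 (by norm_num)
  have hd' : u.PairwiseDisjoint (fun B => ball B.1 B.2) :=
    fun b hb b' hb' hne => (hd hb hb' hne).mono ball_subset_closedBall ball_subset_closedBall
  have hcount : u.Countable := hd'.countable_of_isOpen (fun _ _ => isOpen_ball)
    (fun B hB => ⟨B.1, mem_ball_self (hut hB).1⟩)
  have hcov : {y | a < N μ g x₀ R y} ⊆ ⋃ B ∈ u, ball B.1 (8 * B.2) := by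
    intro y hy
    obtain ⟨x, r, h1, h2, h3, h⟩ := lt_N.1 hy
    have : ∃ B ∈ t, y ∈ ball B.1 B.2 := by
      by_cases hr : r ≤ 2 * R
      · exact ⟨(x, r), ⟨h1, hr, h3, h⟩, h2⟩
      · push Not at hr
        have hx : x ∈ ball x₀ R := h3 (mem_ball_self h1)
        have hR : 0 < R := pos_of_mem_ball hx
        have e1 : ball x r = ball x₀ R := by
          refine h3.antisymm fun z hz => ?_
          rw [mem_ball] at *
          have := dist_triangle_right z x x₀
          linarith
        have e2 : ball x (2 * R) = ball x₀ R := by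
          refine Set.Subset.antisymm ?_ fun z hz => ?_
          · exact (ball_subset_ball hr.le).trans h3
          · rw [mem_ball] at *
            have := dist_triangle_right z x x₀
            linarith
        refine ⟨(x, 2 * R), ⟨by positivity, le_rfl, e2.le, ?_⟩, ?_⟩
        · simpa only [e2, ← e1] using h
        · simpa only [e2, ← e1] using h2
    obtain ⟨B, hB, hyB⟩ := this
    obtain ⟨b, hb, hs⟩ := hc B hB
    refine Set.mem_biUnion hb ?_
    have := hs (ball_subset_closedBall hyB)
    rw [mem_closedBall] at this
    have := (hut hb).1
    rw [mem_ball]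
    linarith
  calc a * μ {y | a < N μ g x₀ R y}
      ≤ a * ∑' B : u, (c_d : ℝ≥0∞) ^ 3 * μ (ball B.1.1 B.1.2) := by
        gcongr
        refine (measure_mono hcov).trans ((measure_biUnion_le μ hcount _).trans ?_)
        exact ENNReal.tsum_le_tsum fun B => doubling8 hdb _ _ (hut B.2).1
    _ = (c_d : ℝ≥0∞) ^ 3 * ∑' B : u, a * μ (ball B.1.1 B.1.2) := by
        rw [ENNReal.tsum_mul_left, ENNReal.tsum_mul_left]; ring
    _ ≤ (c_d : ℝ≥0∞) ^ 3 * ∑' B : u, ∫⁻ z in ball B.1.1 B.1.2, g z ∂μ := by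
        gcongr with B
        have h := (hut B.2).2.2.2.le
        rw [setLAverage_eq] at h
        refine (ENNReal.le_div_iff_mul_le (Or.inl ?_) (Or.inl ?_)).1 h
        · exact (hopen _ isOpen_ball ⟨_, mem_ball_self (hut B.2).1⟩).ne'
        · exact (hbdd _ isBounded_ball).ne
    _ = (c_d : ℝ≥0∞) ^ 3 * ∫⁻ z in ⋃ B ∈ u, ball B.1 B.2, g z ∂μ := by
        rw [lintegral_biUnion hcount (fun _ _ => measurableSet_ball) hd']
    _ ≤ _ := by
        gcongr
        exact Set.iUnion₂_subset fun B hB => (hut hB).2.2.1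

lemma N_finite_ae [SecondCountableTopology X] {c_d : ℝ≥0} (hdb : IsDoublingMeasure μ c_d)
    (hopen : ∀ U : Set X, IsOpen U → U.Nonempty → 0 < μ U)
    (hbdd : ∀ s : Set X, Bornology.IsBounded s → μ s < ⊤)
    (g : X → ℝ≥0∞) (x₀ : X) (R : ℝ) (hg : ∫⁻ z in ball x₀ R, g z ∂μ ≠ ⊤) :
    ∀ᵐ y ∂μ, N μ g x₀ R y ≠ ⊤ := by
  rw [ae_iff]
  by_contra hne
  set m := μ {y | ¬ N μ g x₀ R y ≠ ⊤} with hm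
  have key : ∀ n : ℕ, (n : ℝ≥0∞) * m ≤ (c_d : ℝ≥0∞) ^ 3 * ∫⁻ z in ball x₀ R, g z ∂μ := by
    intro n
    refine le_trans ?_ (weak_type hdb hopen hbdd g x₀ R n)
    gcongr
    rw [hm]
    refine measure_mono fun y hy => ?_
    have hy : N μ g x₀ R y = ⊤ := not_not.1 hy
    change (n : ℝ≥0∞) < N μ g x₀ R y
    rw [hy]
    exact ENNReal.natCast_lt_top n
  have hC : (c_d : ℝ≥0∞) ^ 3 * ∫⁻ z in ball x₀ R, g z ∂μ ≠ ⊤ :=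
    ENNReal.mul_ne_top (ENNReal.pow_ne_top ENNReal.coe_ne_top) hg
  obtain ⟨n, hn⟩ := ENNReal.exists_nat_mul_gt hne hC
  exact absurd (key n) (not_le.2 hn)

lemma isUnifLocDoubling {c_d : ℝ≥0} (hdb : IsDoublingMeasure μ c_d) :
    IsUnifLocDoublingMeasure μ := by
  refine ⟨⟨c_d ^ 3, ?_⟩⟩
  filter_upwards [self_mem_nhdsWithin] with ε hε x
  have hε : 0 < ε := hε
  refine (measure_mono (closedBall_subset_ball (by linarith : 2 * ε < 8 * ε))).trans ?_
  refine (doubling8 hdb x ε hε).trans ?_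
  push_cast
  gcongr
  exact ball_subset_closedBall

lemma le_N_ae [SecondCountableTopology X] {c_d : ℝ≥0} (hdb : IsDoublingMeasure μ c_d)
    (hopen : ∀ U : Set X, IsOpen U → U.Nonempty → 0 < μ U)
    (hbdd : ∀ s : Set X, Bornology.IsBounded s → μ s < ⊤)
    (g : X → ℝ≥0∞) (hgm : AEMeasurable g μ) (x₀ : X) (R : ℝ)
    (hg : ∫⁻ z in ball x₀ R, g z ∂μ ≠ ⊤) :
    ∀ᵐ y ∂μ, y ∈ ball x₀ R → g y ≤ N μ g x₀ R y := by
  have := isUnifLocDoubling hdb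
  have : IsLocallyFiniteMeasure μ :=
    ⟨fun x => ⟨ball x 1, ball_mem_nhds x one_pos, hbdd _ isBounded_ball⟩⟩
  have hL := (IsUnifLocDoublingMeasure.vitaliFamily μ 1).ae_tendsto_lintegral_div
    (f := (ball x₀ R).indicator g) (hgm.indicator measurableSet_ball)
    (by rwa [lintegral_indicator measurableSet_ball])
  filter_upwards [hL] with y hy hyB
  rw [Set.indicator_of_mem hyB] at hy
  have hT := hy.comp (IsUnifLocDoublingMeasure.tendsto_closedBall_filterAt (μ := μ) (K := 1)
    (x := y) (l := nhdsWithin 0 (Set.Ioi 0)) (fun _ => y) (fun δ : ℝ => δ) Filter.tendsto_id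
    (by
      filter_upwards [self_mem_nhdsWithin] with δ hδ
      have hδ : 0 < δ := hδ
      exact mem_closedBall_self (by linarith)))
  refine le_of_tendsto hT ?_
  obtain ⟨ρ, hρ, hsub⟩ := Metric.isOpen_iff.1 (isOpen_ball (x := x₀) (ε := R)) y hyB
  filter_upwards [Ioo_mem_nhdsGT hρ] with δ hδ
  simp only [Function.comp]
  have hfin : μ (closedBall y δ) ≠ ⊤ := (hbdd _ isBounded_closedBall).ne
  have hpos : μ (closedBall y δ) ≠ 0 :=
    (lt_of_lt_of_le (hopen (ball y δ) isOpen_ball ⟨y, mem_ball_self hδ.1⟩)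
      (measure_mono ball_subset_closedBall)).ne'
  rw [ENNReal.div_le_iff hpos hfin]
  -- approximate the closed ball from outside by open balls
  have hmeas : Filter.Tendsto (fun δ' => μ (ball y δ')) (nhdsWithin δ (Set.Ioi δ))
      (nhds (μ (closedBall y δ))) := by
    have h := tendsto_measure_biInter_gt (μ := μ) (s := fun δ' : ℝ => ball y δ') (a := δ)
      (fun r _ => measurableSet_ball.nullMeasurableSet) (fun i j _ hij => ball_subset_ball hij)
      ⟨ρ, hδ.2, (hbdd _ isBounded_ball).ne⟩
    have e : (⋂ r, ⋂ (_ : r > δ), ball y r) = closedBall y δ := by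
      ext z
      simp only [Set.mem_iInter, mem_ball, mem_closedBall]
      exact ⟨fun h => le_of_forall_gt fun r hr => h r hr, fun h r hr => lt_of_le_of_lt h hr⟩
    rwa [e] at h
  by_cases hNtop : N μ g x₀ R y = ⊤
  · rw [hNtop, ENNReal.top_mul hpos]; exact le_top
  refine ge_of_tendsto (ENNReal.Tendsto.const_mul hmeas (Or.inr hNtop)) ?_
  filter_upwards [Ioo_mem_nhdsGT hδ.2] with δ' hδ'
  have hδ'0 : 0 < δ' := hδ.1.trans hδ'.1
  have hb := le_N (μ := μ) (g := g) (x₀ := x₀) (R := R) hδ'0 (mem_ball_self hδ'0)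
    ((ball_subset_ball hδ'.2.le).trans hsub)
  rw [setLAverage_eq, ENNReal.div_le_iff
    (hopen _ isOpen_ball ⟨_, mem_ball_self hδ'0⟩).ne' (hbdd _ isBounded_ball).ne] at hb
  refine le_trans ?_ hb
  refine (lintegral_mono (Set.indicator_le_self _ _)).trans ?_
  exact lintegral_mono_set (closedBall_subset_ball hδ'.1)

/-- Splitting of the maximal function at height `t/2`. -/
lemma N_split (hopen : ∀ U : Set X, IsOpen U → U.Nonempty → 0 < μ U)
    (hbdd : ∀ s : Set X, Bornology.IsBounded s → μ s < ⊤)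
    (g h : X → ℝ≥0∞) (x₀ : X) (R : ℝ) (a : ℝ≥0∞) (ha : a ≠ ⊤) (hgh : ∀ x, g x ≤ h x + a) :
    {y | a + a < N μ g x₀ R y} ⊆ {y | a < N μ h x₀ R y} := by
  intro y hy
  obtain ⟨x, r, h1, h2, h3, h4⟩ := lt_N.1 hy
  refine lt_N.2 ⟨x, r, h1, h2, h3, ?_⟩
  have hpos := (hopen (ball x r) isOpen_ball ⟨_, mem_ball_self h1⟩).ne'
  have hfin := (hbdd (ball x r) isBounded_ball).ne
  have : ⨍⁻ z in ball x r, g z ∂μ ≤ (⨍⁻ z in ball x r, h z ∂μ) + a := by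
    rw [setLAverage_eq, setLAverage_eq]
    calc (∫⁻ z in ball x r, g z ∂μ) / μ (ball x r)
        ≤ ((∫⁻ z in ball x r, h z ∂μ) + a * μ (ball x r)) / μ (ball x r) := by
          gcongr
          refine (lintegral_mono hgh).trans ?_
          rw [lintegral_add_right _ measurable_const, setLIntegral_const]
      _ = _ := by
          rw [ENNReal.add_div, ENNReal.mul_div_cancel_right hpos hfin]
  have h5 := h4.trans_le this
  exact (ENNReal.add_lt_add_iff_right ha).1 h5

/-- Strong type: the maximal function is in `L^q`. -/
lemma strong_type [SecondCountableTopology X] {c_d : ℝ≥0} (hdb : IsDoublingMeasure μ c_d)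
    (hopen : ∀ U : Set X, IsOpen U → U.Nonempty → 0 < μ U)
    (hbdd : ∀ s : Set X, Bornology.IsBounded s → μ s < ⊤)
    (f : X → ℝ) (hf : ∀ x, 0 ≤ f x) (hfm : AEMeasurable f μ) (x₀ : X) (R : ℝ)
    (q : ℝ) (hq : 1 < q)
    (hg : ∫⁻ z in ball x₀ R, ENNReal.ofReal (f z ^ q) ∂μ ≠ ⊤) :
    ∫⁻ y, ENNReal.ofReal ((N μ (fun z => ENNReal.ofReal (f z)) x₀ R y).toReal ^ q) ∂μ ≠ ⊤ := by
  set g : X → ℝ≥0∞ := fun z => ENNReal.ofReal (f z) with hgdef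
  have hgm : AEMeasurable g μ := hfm.ennreal_ofReal
  set ν := (μ.restrict (ball x₀ R)).withDensity g with hν
  have hνac : ν ≪ μ := (withDensity_absolutelyContinuous _ _).trans Measure.absolutelyContinuous_restrict
  have hν2 : ∫⁻ z, ENNReal.ofReal ((2 * f z) ^ (q - 1)) ∂ν ≠ ⊤ := by
    rw [hν, lintegral_withDensity_eq_lintegral_mul₀ hgm.restrict]
    · have : ∀ z, (g * fun z => ENNReal.ofReal ((2 * f z) ^ (q - 1))) z
          = ENNReal.ofReal (2 ^ (q - 1)) * ENNReal.ofReal (f z ^ q) := by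
        intro z
        simp only [Pi.mul_apply, hgdef]
        rw [← ENNReal.ofReal_mul (hf z), ← ENNReal.ofReal_mul (by positivity)]
        congr 1
        rw [Real.mul_rpow (by norm_num) (hf z)]
        have : f z * f z ^ (q - 1) = f z ^ q := by
          have h := Real.rpow_add_of_nonneg (hf z) zero_le_one (by linarith : 0 ≤ q - 1)
          rw [Real.rpow_one] at h
          rw [← h]; congr 1; ring
        rw [← this]; ring
      simp_rw [this]
      rw [lintegral_const_mul' _ _ ENNReal.ofReal_ne_top]
      exact ENNReal.mul_ne_top ENNReal.ofReal_ne_top hg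
    · exact ((hfm.restrict.const_mul 2).pow_const _).ennreal_ofReal
  rw [lintegral_rpow_eq_lintegral_meas_lt_mul ν
    (Filter.Eventually.of_forall fun z => by have := hf z; simp; positivity)
    ((hfm.mono_ac hνac).const_mul 2) (by linarith : 0 < q - 1)] at hν2
  have hν3 : ∫⁻ t in Set.Ioi (0 : ℝ), ν {a | t < 2 * f a} * ENNReal.ofReal (t ^ (q - 1 - 1)) ≠ ⊤ := by
    intro h
    rw [h] at hν2
    apply hν2
    rw [ENNReal.mul_top]
    simp only [ne_eq, ENNReal.ofReal_eq_zero, not_le]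
    linarith
  rw [lintegral_rpow_eq_lintegral_meas_lt_mul μ (Filter.Eventually.of_forall fun z => by simp)
    (measurable_N g x₀ R).ennreal_toReal.aemeasurable (by linarith : 0 < q)]
  refine ENNReal.mul_ne_top ENNReal.ofReal_ne_top ?_
  refine ne_top_of_le_ne_top
    (ENNReal.mul_ne_top (a := 2 * (c_d : ℝ≥0∞) ^ 3) (by finiteness) hν3) ?_
  rw [← lintegral_const_mul' _ _ (by finiteness)]
  refine setLIntegral_mono' measurableSet_Ioi fun t ht => ?_
  have ht : 0 < t := ht
  -- the weak type estimate at height `t`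
  have hw : μ {a | t < (N μ g x₀ R a).toReal}
      ≤ 2 * (c_d : ℝ≥0∞) ^ 3 * (ENNReal.ofReal t)⁻¹ * ν {a | t < 2 * f a} := by
    obtain ⟨s, hs, rfl⟩ : ∃ s, 0 < s ∧ t = 2 * s := ⟨t / 2, by positivity, by ring⟩
    set a := ENNReal.ofReal s with hadef
    set h : X → ℝ≥0∞ := {z | a < g z}.indicator g with hh
    have hs1 : {y | 2 * s < (N μ g x₀ R y).toReal} ⊆ {y | a < N μ h x₀ R y} := by
      refine Set.Subset.trans ?_ (N_split hopen hbdd g h x₀ R a ENNReal.ofReal_ne_top ?_)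
      · intro y hy
        have hy : 2 * s < (N μ g x₀ R y).toReal := hy
        have := (ENNReal.ofReal_lt_iff_lt_toReal (by positivity) (by
          intro htop; rw [htop] at hy; simp at hy; linarith)).2 hy
        rw [two_mul, ENNReal.ofReal_add hs.le hs.le] at this
        exact this
      · intro x
        by_cases hx : a < g x
        · rw [hh, Set.indicator_of_mem (by exact hx)]; exact le_self_add
        · exact (not_lt.1 hx).trans le_add_self
    have hnull : NullMeasurableSet {z | a < g z} μ := nullMeasurableSet_lt aemeasurable_const hgm
    have hint : ∫⁻ z in ball x₀ R, h z ∂μ = ν {z | 2 * s < 2 * f z} := by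
      have e : {z | 2 * s < 2 * f z} = {z | a < g z} := by
        ext z
        change 2 * s < 2 * f z ↔ ENNReal.ofReal s < ENNReal.ofReal (f z)
        rw [ENNReal.ofReal_lt_ofReal_iff_of_nonneg hs.le]
        constructor <;> intro <;> linarith
      rw [e, hν, withDensity_apply₀ _ (hnull.mono_ac (by
        exact Measure.absolutelyContinuous_restrict)), hh,
        lintegral_indicator₀ (hnull.mono_ac Measure.absolutelyContinuous_restrict)]
    have hwt := weak_type hdb hopen hbdd h x₀ R a
    rw [hint] at hwt
    have ha0 : a ≠ 0 := by simp [hadef, hs]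
    have hat : a ≠ ⊤ := ENNReal.ofReal_ne_top
    have e2 : ENNReal.ofReal (2 * s) = 2 * a := by
      rw [ENNReal.ofReal_mul (by norm_num)]; simp [hadef]
    rw [e2]
    calc μ {y | 2 * s < (N μ g x₀ R y).toReal} ≤ μ {y | a < N μ h x₀ R y} := measure_mono hs1
      _ = a⁻¹ * (a * μ {y | a < N μ h x₀ R y}) := by
        rw [← mul_assoc, ENNReal.inv_mul_cancel ha0 hat, one_mul]
      _ ≤ a⁻¹ * ((c_d : ℝ≥0∞) ^ 3 * ν {z | 2 * s < 2 * f z}) := by gcongr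
      _ = (2 * 2⁻¹) * (a⁻¹ * ((c_d : ℝ≥0∞) ^ 3 * ν {z | 2 * s < 2 * f z})) := by
        rw [ENNReal.mul_inv_cancel (by norm_num) (by norm_num), one_mul]
      _ = _ := by
        rw [ENNReal.mul_inv (Or.inl (by norm_num)) (Or.inl (by norm_num))]; ring
  calc _ ≤ 2 * (c_d : ℝ≥0∞) ^ 3 * (ENNReal.ofReal t)⁻¹ * ν {a | t < 2 * f a}
        * ENNReal.ofReal (t ^ (q - 1)) := by gcongr
    _ = 2 * (c_d : ℝ≥0∞) ^ 3 * (ν {a | t < 2 * f a}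
        * ((ENNReal.ofReal t)⁻¹ * ENNReal.ofReal (t ^ (q - 1)))) := by ring
    _ = _ := by
      rw [← ENNReal.ofReal_inv_of_pos ht, ← ENNReal.ofReal_mul (by positivity),
        Real.rpow_sub_one ht.ne' (q - 1), div_eq_inv_mul]

/-- Good-λ type estimate. -/
lemma good_lambda [SecondCountableTopology X] {c_d : ℝ≥0} (hdb : IsDoublingMeasure μ c_d)
    (g : X → ℝ≥0∞) (x₀ : X) (r₀ : ℝ) (p : ℝ) (hp : 0 < p) (K : ℝ≥0∞)
    (hRH : ∀ x r, 0 < r → ∫⁻ z in ball x r, g z ^ p ∂μ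
      ≤ K * (⨍⁻ z in ball x r, g z ∂μ) ^ p * μ (ball x r))
    (a : ℝ≥0∞) (y₀ : X) (hy₀ : y₀ ∈ ball x₀ r₀) (hNy : N μ g x₀ (100 * r₀) y₀ ≤ a) :
    ∫⁻ z in ball x₀ r₀ ∩ {y | a < N μ g x₀ (100 * r₀) y}, g z ^ p ∂μ
      ≤ K * (c_d : ℝ≥0∞) ^ 3 * a ^ p * μ {y | a < N μ g x₀ (100 * r₀) y} := by
  set E := {y | a < N μ g x₀ (100 * r₀) y} with hE
  have hEo : IsOpen E := isOpen_lt_N g x₀ _ a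
  have hy₀E : y₀ ∈ Eᶜ := not_lt.2 hNy
  have hr₀ : 0 < r₀ := pos_of_mem_ball hy₀
  let ρ : X → ℝ := fun x => infDist x Eᶜ
  have hρpos : ∀ x ∈ E, 0 < ρ x := fun x hx =>
    (hEo.isClosed_compl.notMem_iff_infDist_pos ⟨y₀, hy₀E⟩).1 (fun h => h hx)
  have hρle : ∀ x ∈ ball x₀ r₀, ρ x ≤ 2 * r₀ := fun x hx => by
    have h1 : ρ x ≤ dist x y₀ := infDist_le_dist_of_mem hy₀E
    have h2 := dist_triangle_right x y₀ x₀
    rw [mem_ball] at hx hy₀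
    linarith
  obtain ⟨u, hut, hd, hc⟩ := Vitali.exists_disjoint_subfamily_covering_enlargement_closedBall
    (ball x₀ r₀ ∩ E) (fun x => x) (fun x => ρ x / 2) (2 * r₀)
    (fun x hx => by have := hρle x hx.1; linarith) 5 (by norm_num)
  have hd' : u.PairwiseDisjoint (fun x => ball x (ρ x / 2)) :=
    fun b hb b' hb' hne => (hd hb hb' hne).mono ball_subset_closedBall ball_subset_closedBall
  have hpos : ∀ x ∈ u, 0 < ρ x := fun x hx => hρpos x (hut hx).2
  have hcount : u.Countable := hd'.countable_of_isOpen (fun _ _ => isOpen_ball)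
    (fun x hx => ⟨x, mem_ball_self (half_pos (hpos x hx))⟩)
  have hcov : ball x₀ r₀ ∩ E ⊆ ⋃ x ∈ u, ball x (8 * (ρ x / 2)) := by
    intro y hy
    obtain ⟨b, hb, hs⟩ := hc y hy
    refine Set.mem_biUnion hb ?_
    have := hs (mem_closedBall_self (half_pos (hρpos y hy.2)).le)
    rw [mem_closedBall] at this
    have := hpos b hb
    rw [mem_ball]
    linarith
  have hball : ∀ x ∈ u, ∫⁻ z in ball x (8 * (ρ x / 2)), g z ^ p ∂μ
      ≤ K * (c_d : ℝ≥0∞) ^ 3 * a ^ p * μ (ball x (ρ x / 2)) := by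
    intro x hx
    have hx0 := hpos x hx
    obtain ⟨z, hz, hzd⟩ : ∃ z ∈ Eᶜ, dist x z < 8 * (ρ x / 2) :=
      (infDist_lt_iff ⟨y₀, hy₀E⟩).1 (by change ρ x < _; linarith)
    have havg : ⨍⁻ z in ball x (8 * (ρ x / 2)), g z ∂μ ≤ a := by
      refine le_trans (le_N (x₀ := x₀) (R := 100 * r₀) (y := z) (by linarith) ?_ ?_) (not_lt.1 hz)
      · rwa [mem_ball, dist_comm]
      · intro w hw
        have h1 := hρle x (hut hx).1
        have h2 := (hut hx).1
        rw [mem_ball] at *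
        have := dist_triangle w x x₀
        linarith
    calc _ ≤ K * (⨍⁻ z in ball x (8 * (ρ x / 2)), g z ∂μ) ^ p * μ (ball x (8 * (ρ x / 2))) :=
          hRH x _ (by linarith)
      _ ≤ K * a ^ p * ((c_d : ℝ≥0∞) ^ 3 * μ (ball x (ρ x / 2))) := by
          gcongr
          exact doubling8 hdb _ _ (by linarith)
      _ = _ := by ring
  calc ∫⁻ z in ball x₀ r₀ ∩ E, g z ^ p ∂μ
      ≤ ∫⁻ z in ⋃ x ∈ u, ball x (8 * (ρ x / 2)), g z ^ p ∂μ := lintegral_mono_set hcov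
    _ ≤ ∑' x : u, ∫⁻ z in ball (x : X) (8 * (ρ x / 2)), g z ^ p ∂μ := by
        have := hcount.to_subtype
        rw [Set.biUnion_eq_iUnion]
        exact lintegral_iUnion_le _ _
    _ ≤ ∑' x : u, K * (c_d : ℝ≥0∞) ^ 3 * a ^ p * μ (ball (x : X) (ρ x / 2)) :=
        ENNReal.tsum_le_tsum fun x => hball x x.2
    _ = K * (c_d : ℝ≥0∞) ^ 3 * a ^ p * μ (⋃ x ∈ u, ball x (ρ x / 2)) := by
        rw [ENNReal.tsum_mul_left, measure_biUnion hcount hd' (fun _ _ => measurableSet_ball)]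
    _ ≤ _ := by
        gcongr
        refine Set.iUnion₂_subset fun x hx => ?_
        exact (ball_subset_ball (by have := hpos x hx; linarith)).trans ball_infDist_compl_subset

/-- The layer cake step, for an abstract function `M`. -/
lemma layer_step (g : X → ℝ≥0∞) (hgm : AEMeasurable g μ) (M : X → ℝ) (hM0 : ∀ x, 0 ≤ M x)
    (hMm : Measurable M) (B : Set X) (hB : MeasurableSet B) (p q α : ℝ) (hp : 0 < p) (hpq : p < q)
    (hα : 0 ≤ α) (C : ℝ≥0∞) (hC : C ≠ ⊤)
    (hgM : ∀ᵐ x ∂μ, x ∈ B → g x ≤ ENNReal.ofReal (M x))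
    (hgl : ∀ t, α ≤ t → ∫⁻ z in B ∩ {y | t < M y}, g z ^ p ∂μ
      ≤ C * ENNReal.ofReal (t ^ p) * μ {y | t < M y}) :
    ∫⁻ z in B ∩ {y | α < M y}, g z ^ q ∂μ ≤
      C * ENNReal.ofReal (α ^ q) * μ {y | α < M y} +
      C * ENNReal.ofReal ((q - p) / q) * ∫⁻ z, ENNReal.ofReal (M z ^ q) ∂μ := by
  have hs : 0 < q - p := by linarith
  have hq : 0 < q := by linarith
  have hms : ∀ t, MeasurableSet {y | t < M y} := fun t => measurableSet_lt measurable_const hMm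
  set S := B ∩ {y | α < M y} with hS
  have hSm : MeasurableSet S := hB.inter (hms α)
  have hgpm : AEMeasurable (fun z => g z ^ p) (μ.restrict S) := (hgm.pow_const p).restrict
  set ν := (μ.restrict S).withDensity (fun z => g z ^ p) with hν
  have hνac : ν ≪ μ :=
    (withDensity_absolutelyContinuous _ _).trans Measure.absolutelyContinuous_restrict
  have hνle : ∀ t, α ≤ t → ν {y | t < M y} ≤ C * ENNReal.ofReal (t ^ p) * μ {y | t < M y} := by
    intro t ht
    refine le_trans ?_ (hgl t ht)
    rw [hν, withDensity_apply _ (hms t), Measure.restrict_restrict (hms t)]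
    refine lintegral_mono_set ?_
    rintro z ⟨h1, h2, h3⟩
    exact ⟨h2, h1⟩
  have hνall : ∀ t, ν {y | t < M y} ≤ C * ENNReal.ofReal (α ^ p) * μ {y | α < M y} := by
    intro t
    refine le_trans ?_ (hgl α le_rfl)
    rw [hν, withDensity_apply _ (hms t), Measure.restrict_restrict (hms t)]
    exact lintegral_mono_set Set.inter_subset_right
  have step1 : ∫⁻ z in S, g z ^ q ∂μ ≤ ∫⁻ z, ENNReal.ofReal (M z ^ (q - p)) ∂ν := by
    rw [hν, lintegral_withDensity_eq_lintegral_mul₀ hgpm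
      ((hMm.pow_const _).ennreal_ofReal.aemeasurable)]
    refine lintegral_mono_ae ((ae_restrict_iff' hSm).2 ?_)
    filter_upwards [hgM] with z hz hzS
    have h := hz hzS.1
    simp only [Pi.mul_apply]
    rw [← ENNReal.ofReal_rpow_of_nonneg (hM0 z) hs.le]
    calc g z ^ q = g z ^ (p + (q - p)) := by congr 1; ring
      _ = g z ^ p * g z ^ (q - p) := ENNReal.rpow_add_of_nonneg _ _ hp.le hs.le
      _ ≤ _ := by gcongr
  refine step1.trans ?_
  rw [lintegral_rpow_eq_lintegral_meas_lt_mul ν (Filter.Eventually.of_forall hM0)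
    hMm.aemeasurable hs, lintegral_rpow_eq_lintegral_meas_lt_mul μ
    (Filter.Eventually.of_forall hM0) hMm.aemeasurable hq]
  have hsplit : Set.Ioi (0 : ℝ) = Set.Ioc 0 α ∪ Set.Ioi α := (Set.Ioc_union_Ioi_eq_Ioi hα).symm
  have hlow : ENNReal.ofReal (q - p) * ∫⁻ t in Set.Ioc 0 α, ENNReal.ofReal (t ^ (q - p - 1))
      = ENNReal.ofReal (α ^ (q - p)) := by
    rw [← ofReal_integral_eq_lintegral_ofReal, ← intervalIntegral.integral_of_le hα,
      integral_rpow (Or.inl (by linarith)), ← ENNReal.ofReal_mul hs.le]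
    · congr 1
      rw [sub_add_cancel, Real.zero_rpow hs.ne']
      field_simp
      ring
    · rw [← IntegrableOn, ← intervalIntegrable_iff_integrableOn_Ioc_of_le hα]
      exact intervalIntegral.intervalIntegrable_rpow' (by linarith)
    · exact (ae_restrict_iff' measurableSet_Ioc).2 <| Filter.Eventually.of_forall fun t ht => Real.rpow_nonneg ht.1.le _
  have hαq : ENNReal.ofReal (α ^ q) = ENNReal.ofReal (α ^ p) * ENNReal.ofReal (α ^ (q - p)) := by
    rw [← ENNReal.ofReal_mul (Real.rpow_nonneg hα _), ← Real.rpow_add_of_nonneg hα hp.le hs.le]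
    congr 2; ring
  calc ENNReal.ofReal (q - p) *
        ∫⁻ t in Set.Ioi 0, ν {a | t < M a} * ENNReal.ofReal (t ^ (q - p - 1))
      ≤ ENNReal.ofReal (q - p) *
        ((∫⁻ t in Set.Ioc 0 α, ν {a | t < M a} * ENNReal.ofReal (t ^ (q - p - 1))) +
         ∫⁻ t in Set.Ioi α, ν {a | t < M a} * ENNReal.ofReal (t ^ (q - p - 1))) := by
        gcongr
        rw [hsplit]
        exact lintegral_union_le _ _ _
    _ ≤ ENNReal.ofReal (q - p) *
        ((∫⁻ t in Set.Ioc 0 α, (C * ENNReal.ofReal (α ^ p) * μ {y | α < M y}) *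
            ENNReal.ofReal (t ^ (q - p - 1))) +
         ∫⁻ t in Set.Ioi α, C * (μ {a | t < M a} * ENNReal.ofReal (t ^ (q - 1)))) := by
        refine mul_le_mul' le_rfl (add_le_add ?_ ?_)
        · exact lintegral_mono fun t => by gcongr; exact hνall t
        · refine setLIntegral_mono' measurableSet_Ioi fun t ht => ?_
          have ht : α < t := ht
          have ht0 : 0 < t := lt_of_le_of_lt hα ht
          refine (mul_le_mul_left (hνle t ht.le) _).trans (le_of_eq ?_)
          have : ENNReal.ofReal (t ^ (q - 1))
              = ENNReal.ofReal (t ^ p) * ENNReal.ofReal (t ^ (q - p - 1)) := by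
            rw [← ENNReal.ofReal_mul (Real.rpow_nonneg ht0.le _), ← Real.rpow_add ht0]
            congr 2; ring
          rw [this]; ring
    _ = (C * ENNReal.ofReal (α ^ p) * μ {y | α < M y}) *
          (ENNReal.ofReal (q - p) * ∫⁻ t in Set.Ioc 0 α, ENNReal.ofReal (t ^ (q - p - 1))) +
        C * ENNReal.ofReal (q - p) *
          ∫⁻ t in Set.Ioi α, (μ {a | t < M a} * ENNReal.ofReal (t ^ (q - 1))) := by
        rw [lintegral_const_mul, lintegral_const_mul' _ _ hC]
        · ring
        · fun_prop
    _ ≤ C * ENNReal.ofReal (α ^ q) * μ {y | α < M y} + C * ENNReal.ofReal (q - p) *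
          ∫⁻ t in Set.Ioi 0, (μ {a | t < M a} * ENNReal.ofReal (t ^ (q - 1))) := by
        rw [hlow, hαq]
        gcongr ?_ + _ * ?_
        · exact le_of_eq (by ring)
        · exact lintegral_mono_set (Set.Ioi_subset_Ioi hα)
    _ = _ := by
        congr 1
        rw [← mul_assoc, mul_assoc C _ (ENNReal.ofReal q), ← ENNReal.ofReal_mul (by positivity),
          div_mul_cancel₀ _ hq.ne']

lemma limit_step (g : X → ℝ≥0∞) (M : X → ℝ) (hMm : Measurable M) (B : Set X)
    (p α : ℝ) (hp : 0 < p) (C : ℝ≥0∞) (hC : C ≠ ⊤) (hfin : μ {y | α < M y} ≠ ⊤)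
    (hgl : ∀ t, α < t → ∫⁻ z in B ∩ {y | t < M y}, g z ^ p ∂μ
      ≤ C * ENNReal.ofReal (t ^ p) * μ {y | t < M y}) :
    ∫⁻ z in B ∩ {y | α < M y}, g z ^ p ∂μ
      ≤ C * ENNReal.ofReal (α ^ p) * μ {y | α < M y} := by
  have hms : ∀ t, MeasurableSet {y | t < M y} := fun t => measurableSet_lt measurable_const hMm
  set ν := (μ.restrict B).withDensity (fun z => g z ^ p) with hν
  have hνe : ∀ t, ν {y | t < M y} = ∫⁻ z in B ∩ {y | t < M y}, g z ^ p ∂μ := fun t => by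
    rw [hν, withDensity_apply _ (hms t), Measure.restrict_restrict (hms t), Set.inter_comm]
  obtain ⟨u, hua, hul, hut⟩ := exists_seq_strictAnti_tendsto α
  have hU : {y | α < M y} = ⋃ n, {y | u n < M y} := by
    ext y
    rw [Set.mem_iUnion]
    constructor
    · intro hy
      exact ((hut.eventually (gt_mem_nhds (show α < M y from hy))).exists)
    · rintro ⟨n, hn⟩
      exact (hul n).trans hn
  have hT : Filter.Tendsto (fun n => ν {y | u n < M y}) Filter.atTop (nhds (ν {y | α < M y})) := by
    rw [hU]
    exact tendsto_measure_iUnion_atTop fun m n hmn y hy => lt_of_le_of_lt (hua.antitone hmn) hy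
  rw [← hνe]
  have hT2 : Filter.Tendsto (fun n => C * ENNReal.ofReal (u n ^ p) * μ {y | α < M y}) Filter.atTop
      (nhds (C * ENNReal.ofReal (α ^ p) * μ {y | α < M y})) := by
    refine ENNReal.Tendsto.mul_const ?_ (Or.inr hfin)
    refine ENNReal.Tendsto.const_mul ?_ (Or.inr hC)
    refine (ENNReal.continuous_ofReal.tendsto _).comp ?_
    exact ((Real.continuous_rpow_const hp.le).tendsto α).comp hut
  refine le_of_tendsto_of_tendsto' hT hT2 fun n => ?_
  rw [hνe]
  refine (hgl (u n) (hul n)).trans ?_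
  gcongr
  exact (hul n).le

lemma essInf_facts (M : X → ℝ) (hM0 : ∀ x, 0 ≤ M x) (ν : Measure X) (hν : ν ≠ 0) :
    0 ≤ essInf M ν ∧ ∀ t, essInf M ν < t → ¬ ∀ᵐ y ∂ν, t ≤ M y := by
  have hne : (ae ν).NeBot := ae_neBot.2 hν
  have he : essInf M ν = sSup {a | ∀ᵐ y ∂ν, a ≤ M y} := Filter.liminf_eq
  have hbdd : BddAbove {a | ∀ᵐ y ∂ν, a ≤ M y} := by
    by_contra hnb
    have h : ∀ n : ℕ, ∀ᵐ y ∂ν, (n : ℝ) ≤ M y := by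
      intro n
      rw [not_bddAbove_iff] at hnb
      obtain ⟨a, ha, han⟩ := hnb n
      filter_upwards [show ∀ᵐ y ∂ν, a ≤ M y from ha] with y hy
      linarith
    obtain ⟨y, hy⟩ := (ae_all_iff.2 h).exists
    obtain ⟨n, hn⟩ := exists_nat_gt (M y)
    exact absurd (hy n) (not_le.2 hn)
  rw [he]
  refine ⟨le_csSup hbdd (show ∀ᵐ y ∂ν, 0 ≤ M y from Filter.Eventually.of_forall hM0), fun t ht hall => ?_⟩
  exact absurd (le_csSup hbdd hall) (not_le.2 ht)

end RHM

/-- **Lemma 3.6.** Let `1 < p < q < ∞` and let `f ∈ L^q_loc` be non-negative satisfying the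
reverse Hölder inequality with exponent `p` and constant `c`. Then for every ball
`B₀ = B(x₀, r₀)`, with `α = ess inf_{B₀} Mf` (`Mf` restricted to `100B₀`),
`∫_{B₀ ∩ {Mf > α}} f^q dμ ≤ c' α^q μ(100B₀ ∩ {Mf > α}) + c' ((q−p)/q) ∫_{100B₀} (Mf)^q dμ`,
where `c'` depends only on `p`, the doubling constant and `c`. -/
theorem reverse_holder_maximal_estimate {X : Type*} [MetricSpace X] [MeasurableSpace X]
    [BorelSpace X] (μ : Measure X)
    (hopen : ∀ U : Set X, IsOpen U → U.Nonempty → 0 < μ U)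
    (hbdd : ∀ s : Set X, Bornology.IsBounded s → μ s < ⊤)
    (c_d : ℝ≥0) (hdb : IsDoublingMeasure μ c_d)
    (p c : ℝ) (hp : 1 < p) :
    ∃ c' : ℝ, 0 < c' ∧
      ∀ q : ℝ, p < q →
      ∀ f : X → ℝ, (∀ x, 0 ≤ f x) →
        (∀ (x : X) (r : ℝ), 0 < r → IntegrableOn (fun y => f y ^ q) (ball x r) μ) →
        ReverseHolder μ p c f →
        ∀ (x₀ : X) (r₀ : ℝ), 0 < r₀ →
          ∫ y in ball x₀ r₀ ∩
              {z | essInf (restrictedMaximal μ f x₀ r₀) (μ.restrict (ball x₀ r₀)) <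
                restrictedMaximal μ f x₀ r₀ z},
              f y ^ q ∂μ ≤
            c' * (essInf (restrictedMaximal μ f x₀ r₀) (μ.restrict (ball x₀ r₀))) ^ q *
                (μ (ball x₀ (100 * r₀) ∩
                  {z | essInf (restrictedMaximal μ f x₀ r₀) (μ.restrict (ball x₀ r₀)) <
                    restrictedMaximal μ f x₀ r₀ z})).toReal +
              c' * ((q - p) / q) *
                ∫ y in ball x₀ (100 * r₀), (restrictedMaximal μ f x₀ r₀ y) ^ q ∂μ := by
  refine ⟨|c| ^ p * (c_d : ℝ) ^ 3 + 1, by positivity, ?_⟩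
  intro q hpq f hf hfq hRH x₀ r₀ hr₀
  set c' : ℝ := |c| ^ p * (c_d : ℝ) ^ 3 + 1 with hc'
  have hc'0 : 0 < c' := by positivity
  have hne : Nonempty X := ⟨x₀⟩
  have hσ : SigmaFinite μ := RHM.sigmaFinite_of_bdd hbdd
  have hsc : SecondCountableTopology X := RHM.secondCountable_of_bdd hopen
  have hp0 : 0 < p := by linarith
  have hq0 : 0 < q := by linarith
  have hq1 : 1 < q := by linarith
  -- measurability and local integrability of `f`
  have hfm : AEMeasurable f μ := by
    have h : AEMeasurable (fun y => f y ^ q) μ := by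
      rw [← Measure.restrict_univ (μ := μ), ← iUnion_ball_nat_succ x₀, aemeasurable_iUnion_iff]
      intro n
      exact (hfq x₀ _ (by positivity)).1.aemeasurable
    have h2 := h.pow_const (1 / q)
    refine h2.congr (Filter.Eventually.of_forall fun x => ?_)
    change (f x ^ q) ^ (1 / q) = f x
    rw [← Real.rpow_mul (hf x), mul_one_div_cancel hq0.ne', Real.rpow_one]
  have hfi : ∀ x r, 0 < r → IntegrableOn f (ball x r) μ := by
    intro x r hr
    have h1 : IntegrableOn (fun y => 1 + f y ^ q) (ball x r) μ :=
      (integrableOn_const (hbdd _ isBounded_ball).ne).add (hfq x r hr)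
    refine Integrable.mono' h1 hfm.restrict.aestronglyMeasurable
      (Filter.Eventually.of_forall fun y => ?_)
    rw [Real.norm_of_nonneg (hf y)]
    rcases le_total (f y) 1 with h | h
    · have := Real.rpow_nonneg (hf y) q
      linarith
    · have := Real.self_le_rpow_of_one_le h hq1.le
      linarith
  set g : X → ℝ≥0∞ := fun z => ENNReal.ofReal (f z) with hg
  have hgm : AEMeasurable g μ := hfm.ennreal_ofReal
  have hgp : ∀ s : ℝ, 0 ≤ s → ∀ z, g z ^ s = ENNReal.ofReal (f z ^ s) := fun s hs z =>
    ENNReal.ofReal_rpow_of_nonneg (hf z) hs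
  have havg : ∀ x r, 0 < r → ⨍⁻ z in ball x r, g z ∂μ = ENNReal.ofReal (⨍ z in ball x r, f z ∂μ) := by
    intro x r hr
    rw [ofReal_setAverage (hfi x r hr) (Filter.Eventually.of_forall hf), setLAverage_eq]
  have havg0 : ∀ x r, 0 ≤ ⨍ z in ball x r, f z ∂μ := fun x r => by
    rw [setAverage_eq]
    exact smul_nonneg (by positivity) (integral_nonneg hf)
  set M := restrictedMaximal μ f x₀ r₀ with hMdef
  have hMN : ∀ y, M y = (RHM.N μ g x₀ (100 * r₀) y).toReal := by
    intro y
    rw [hMdef, restrictedMaximal, RHM.N, ENNReal.toReal_sSup, Set.image_image]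
    · congr 1
      refine Set.image_congr fun B hB => ?_
      rw [havg _ _ hB.1, ENNReal.toReal_ofReal (havg0 _ _)]
      simp only [abs_of_nonneg (hf _)]
    · rintro _ ⟨B, hB, rfl⟩
      simp only
      rw [havg _ _ hB.1]
      exact ENNReal.ofReal_ne_top
  have hM0 : ∀ y, 0 ≤ M y := fun y => by rw [hMN]; exact ENNReal.toReal_nonneg
  have hMm : Measurable M := by
    rw [funext hMN]
    exact (RHM.measurable_N g x₀ _).ennreal_toReal
  have hR : 0 < 100 * r₀ := by positivity
  have hgfin : ∫⁻ z in ball x₀ (100 * r₀), g z ∂μ ≠ ⊤ := by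
    rw [← ofReal_integral_eq_lintegral_ofReal (hfi x₀ _ hR) (Filter.Eventually.of_forall hf)]
    exact ENNReal.ofReal_ne_top
  have hgqfin : ∫⁻ z in ball x₀ (100 * r₀), ENNReal.ofReal (f z ^ q) ∂μ ≠ ⊤ := by
    rw [← ofReal_integral_eq_lintegral_ofReal (hfq x₀ _ hR)
      (Filter.Eventually.of_forall fun z => Real.rpow_nonneg (hf z) q)]
    exact ENNReal.ofReal_ne_top
  have hNfin := RHM.N_finite_ae hdb hopen hbdd g x₀ (100 * r₀) hgfin
  have hMsub : ∀ t, 0 ≤ t → {y | t < M y} ⊆ ball x₀ (100 * r₀) := by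
    intro t ht y hy
    refine RHM.lt_N_subset (μ := μ) g x₀ (100 * r₀) 0 ?_
    have hy : t < M y := hy
    change 0 < RHM.N μ g x₀ (100 * r₀) y
    rw [hMN] at hy
    exact (ENNReal.toReal_pos_iff.1 (ht.trans_lt hy)).1
  -- reverse Hölder in `ℝ≥0∞` form
  have hRH' : ∀ x r, 0 < r → ∫⁻ z in ball x r, g z ^ p ∂μ
      ≤ ENNReal.ofReal (|c| ^ p) * (⨍⁻ z in ball x r, g z ∂μ) ^ p * μ (ball x r) := by
    intro x r hr
    obtain ⟨hi, hle⟩ := hRH x r hr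
    have hpos := (hopen (ball x r) isOpen_ball ⟨_, mem_ball_self hr⟩).ne'
    have hfin := (hbdd (ball x r) isBounded_ball).ne
    have h0 : ∀ᵐ z ∂μ.restrict (ball x r), 0 ≤ f z ^ p :=
      Filter.Eventually.of_forall fun z => Real.rpow_nonneg (hf z) p
    have hA0 : 0 ≤ ⨍ z in ball x r, f z ^ p ∂μ := by
      rw [setAverage_eq]
      exact smul_nonneg (by positivity) (integral_nonneg_of_ae h0)
    have hA : ⨍ z in ball x r, f z ^ p ∂μ ≤ |c| ^ p * (⨍ z in ball x r, f z ∂μ) ^ p := by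
      have h1 : (⨍ z in ball x r, f z ^ p ∂μ) ^ (1 / p) ≤ |c| * ⨍ z in ball x r, f z ∂μ :=
        hle.trans (mul_le_mul_of_nonneg_right (le_abs_self c) (havg0 x r))
      have h2 := Real.rpow_le_rpow (Real.rpow_nonneg hA0 _) h1 hp0.le
      rwa [← Real.rpow_mul hA0, one_div_mul_cancel hp0.ne', Real.rpow_one,
        Real.mul_rpow (abs_nonneg c) (havg0 x r)] at h2
    have hA2 := ENNReal.ofReal_le_ofReal hA
    rw [ofReal_setAverage hi h0, ENNReal.ofReal_mul (by positivity),
      ← ENNReal.ofReal_rpow_of_nonneg (havg0 x r) hp0.le, ← havg x r hr,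
      ENNReal.div_le_iff hpos hfin] at hA2
    simpa only [hgp p hp0.le] using hA2
  obtain ⟨hα0, hαt⟩ := RHM.essInf_facts M hM0 (μ.restrict (ball x₀ r₀)) (by
    rw [Ne, Measure.restrict_eq_zero]
    exact (hopen _ isOpen_ball ⟨_, mem_ball_self hr₀⟩).ne')
  set α := essInf M (μ.restrict (ball x₀ r₀)) with hα
  have hcle : ENNReal.ofReal (|c| ^ p) * (c_d : ℝ≥0∞) ^ 3 ≤ ENNReal.ofReal c' := by
    have : (c_d : ℝ≥0∞) ^ 3 = ENNReal.ofReal ((c_d : ℝ) ^ 3) := by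
      rw [ENNReal.ofReal_pow (NNReal.coe_nonneg c_d), ENNReal.ofReal_coe_nnreal]
    rw [this, ← ENNReal.ofReal_mul (by positivity)]
    exact ENNReal.ofReal_le_ofReal (by linarith)
  have hgl1 : ∀ t, α < t → ∫⁻ z in ball x₀ r₀ ∩ {y | t < M y}, g z ^ p ∂μ
      ≤ ENNReal.ofReal c' * ENNReal.ofReal (t ^ p) * μ {y | t < M y} := by
    intro t ht
    have ht0 : 0 ≤ t := hα0.trans ht.le
    have hy₀ : ∃ y ∈ ball x₀ r₀, RHM.N μ g x₀ (100 * r₀) y ≤ ENNReal.ofReal t := by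
      by_contra hcon
      push Not at hcon
      refine hαt t ht ((ae_restrict_iff' measurableSet_ball).2 ?_)
      filter_upwards [hNfin] with y hy hyB
      rw [hMN]
      exact (ENNReal.ofReal_le_iff_le_toReal hy).1 (hcon y hyB).le
    obtain ⟨y₀, hy₀B, hy₀⟩ := hy₀
    have hgl := RHM.good_lambda hdb g x₀ r₀ p hp0 (ENNReal.ofReal (|c| ^ p)) hRH'
      (ENNReal.ofReal t) y₀ hy₀B hy₀
    have hsub : {y | t < M y} ⊆ {y | ENNReal.ofReal t < RHM.N μ g x₀ (100 * r₀) y} := by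
      intro y hy
      have hy : t < M y := hy
      rw [hMN] at hy
      by_cases htop : RHM.N μ g x₀ (100 * r₀) y = ⊤
      · change _ < RHM.N μ g x₀ (100 * r₀) y
        rw [htop]; exact ENNReal.ofReal_lt_top
      · exact (ENNReal.ofReal_lt_iff_lt_toReal ht0 htop).2 hy
    have hmeq : μ {y | ENNReal.ofReal t < RHM.N μ g x₀ (100 * r₀) y} ≤ μ {y | t < M y} := by
      refine measure_mono_ae ?_
      filter_upwards [hNfin] with y hy hyt
      change t < M y
      rw [hMN]
      exact (ENNReal.ofReal_lt_iff_lt_toReal ht0 hy).1 hyt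
    calc _ ≤ _ := lintegral_mono_set (Set.inter_subset_inter_right _ hsub)
      _ ≤ _ := hgl
      _ ≤ _ := by
        rw [ENNReal.ofReal_rpow_of_nonneg ht0 hp0.le]
        gcongr
  have hμfin : μ {y | α < M y} ≠ ⊤ :=
    ((measure_mono (hMsub α hα0)).trans_lt (hbdd _ isBounded_ball)).ne
  have hgl2 : ∀ t, α ≤ t → ∫⁻ z in ball x₀ r₀ ∩ {y | t < M y}, g z ^ p ∂μ
      ≤ ENNReal.ofReal c' * ENNReal.ofReal (t ^ p) * μ {y | t < M y} := by
    intro t ht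
    rcases ht.eq_or_lt with rfl | ht
    · exact RHM.limit_step g M hMm _ p α hp0 _ ENNReal.ofReal_ne_top hμfin hgl1
    · exact hgl1 t ht
  have hgM : ∀ᵐ x ∂μ, x ∈ ball x₀ r₀ → g x ≤ ENNReal.ofReal (M x) := by
    filter_upwards [hNfin, RHM.le_N_ae hdb hopen hbdd g hgm x₀ (100 * r₀) hgfin] with y h1 h2 hy
    rw [hMN, ENNReal.ofReal_toReal h1]
    exact h2 (ball_subset_ball (by linarith) hy)
  have main := RHM.layer_step g hgm M hM0 hMm (ball x₀ r₀) measurableSet_ball p q α hp0 hpq hα0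
    (ENNReal.ofReal c') ENNReal.ofReal_ne_top hgM hgl2
  have hstrong : ∫⁻ z, ENNReal.ofReal (M z ^ q) ∂μ ≠ ⊤ := by
    simp_rw [hMN]
    exact RHM.strong_type hdb hopen hbdd f hf hfm x₀ (100 * r₀) q hq1 hgqfin
  have hMint : ∫ y in ball x₀ (100 * r₀), M y ^ q ∂μ
      = (∫⁻ z, ENNReal.ofReal (M z ^ q) ∂μ).toReal := by
    rw [setIntegral_eq_integral_of_forall_compl_eq_zero, integral_eq_lintegral_of_nonneg_ae]
    · exact Filter.Eventually.of_forall fun z => Real.rpow_nonneg (hM0 z) q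
    · exact (hMm.pow_const q).aestronglyMeasurable
    · intro y hy
      have : M y = 0 := le_antisymm (not_lt.1 fun h => hy (hMsub 0 le_rfl h)) (hM0 y)
      rw [this, Real.zero_rpow hq0.ne']
  have hset : ball x₀ (100 * r₀) ∩ {z | α < M z} = {z | α < M z} :=
    Set.inter_eq_right.2 (hMsub α hα0)
  rw [hMint, hset, integral_eq_lintegral_of_nonneg_ae
    (Filter.Eventually.of_forall fun z => Real.rpow_nonneg (hf z) q)
    (hfm.restrict.pow_const q).aestronglyMeasurable]
  simp only [hgp q hq0.le] at main
  have hfinal := ENNReal.toReal_mono (by finiteness) main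
  refine hfinal.trans (le_of_eq ?_)
  rw [ENNReal.toReal_add (by finiteness) (by finiteness)]
  simp only [ENNReal.toReal_mul]
  rw [ENNReal.toReal_ofReal hc'0.le, ENNReal.toReal_ofReal (Real.rpow_nonneg hα0 q),
    ENNReal.toReal_ofReal (div_nonneg (by linarith) hq0.le)]
end

section
/- Let (X, d, μ) be a doubling metric measure space, 1 < p < ∞, and let w ∈ A_p. Then there exists p₁ with 1 < p₁ < p such that w ∈ A_{p₁}; explicitly, with ε > 0 given by the self-improving property of the conjugate weight, p₁ = p/(1+ε) − 1/(1+ε) + 1 works. -/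
open MeasureTheory Metric
open scoped NNReal ENNReal

/-- `w` is an `A_p` Muckenhoupt weight (`1 < p`) with constant `c_w`:
`(⨍_B w dμ) (⨍_B w^(1−p') dμ)^(p−1) ≤ c_w` for all balls `B`, where `p' = p/(p−1)`
(in particular `w^(1−p')` is locally integrable). -/
def IsAp {X : Type*} [MetricSpace X] [MeasurableSpace X]
    (μ : Measure X) (p c_w : ℝ) (w : X → ℝ) : Prop :=
  ∀ (x : X) (r : ℝ), 0 < r →
    IntegrableOn (fun y => w y ^ (1 - p / (p - 1))) (ball x r) μ ∧
    (⨍ y in ball x r, w y ∂μ) *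
      (⨍ y in ball x r, w y ^ (1 - p / (p - 1)) ∂μ) ^ (p - 1) ≤ c_w

namespace ApAux
open Set Filter Topology

lemma sigmaFinite_of_bdd {X : Type*} [MetricSpace X] [MeasurableSpace X]
    (μ : Measure X) (hbdd : ∀ s : Set X, Bornology.IsBounded s → μ s < ⊤) : SigmaFinite μ := by
  rcases isEmpty_or_nonempty X with h | ⟨⟨x0⟩⟩
  · have : μ = 0 := Measure.eq_zero_of_isEmpty μ
    rw [this]; infer_instance
  · refine ⟨⟨⟨fun n => ball x0 n, fun _ => trivial, fun n => hbdd _ isBounded_ball, ?_⟩⟩⟩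
    exact iUnion_ball_nat x0

lemma locFinite_of_ball {X : Type*} [MetricSpace X] [MeasurableSpace X]
    (μ : Measure X) (hbdd : ∀ (x : X) (r : ℝ), 0 < r → μ (ball x r) ≠ ⊤) :
    IsLocallyFiniteMeasure μ :=
  ⟨fun x => ⟨ball x 1, ball_mem_nhds x one_pos, (hbdd x 1 one_pos).lt_top⟩⟩

lemma secondCountable {X : Type*} [MetricSpace X] [MeasurableSpace X]
    [BorelSpace X] (μ : Measure X)
    (hopen : ∀ U : Set X, IsOpen U → U.Nonempty → 0 < μ U)
    (hbdd : ∀ s : Set X, Bornology.IsBounded s → μ s < ⊤) : SecondCountableTopology X := by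
  have := sigmaFinite_of_bdd μ hbdd
  refine Metric.secondCountable_of_almost_dense_set fun ε hε => ?_
  obtain ⟨u, -, hdis, hcov⟩ := Vitali.exists_disjoint_subfamily_covering_enlargement_closedBall
    (univ : Set X) id (fun _ => ε / 5) (ε / 5) (fun _ _ => le_rfl) 5 (by norm_num)
  refine ⟨u, ?_, fun x => ?_⟩
  · have := Measure.countable_meas_pos_of_disjoint_iUnion (μ := μ)
      (As := fun i : u => ball (i : X) (ε / 5)) (fun i => measurableSet_ball) ?_
    · have h2 : {i : u | 0 < μ (ball (i : X) (ε / 5))} = univ := by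
        ext i
        simpa using hopen _ isOpen_ball ⟨i, mem_ball_self (by positivity)⟩
      rw [h2] at this
      exact countable_coe_iff.1 (countable_univ_iff.1 this)
    · intro i j hij
      exact (hdis i.2 j.2 (fun h => hij (Subtype.ext h))).mono ball_subset_closedBall
        ball_subset_closedBall
  · obtain ⟨b, hb, hs⟩ := hcov x (mem_univ x)
    refine ⟨b, hb, ?_⟩
    have := hs (mem_closedBall_self (by positivity))
    simp only [id, mem_closedBall] at this
    linarith

lemma lebesgue {X : Type*} [MetricSpace X] [MeasurableSpace X]
    [BorelSpace X] [SecondCountableTopology X] (μ : Measure X) [SigmaFinite μ]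
    (hpos : ∀ (x : X) (r : ℝ), 0 < r → μ (ball x r) ≠ 0)
    (hfin : ∀ (x : X) (r : ℝ), 0 < r → μ (ball x r) ≠ ⊤)
    (c_d : ℝ≥0) (hdb : IsDoublingMeasure μ c_d)
    (f : X → ℝ≥0∞) (hf : Measurable f)
    (hνfin : ∀ (x : X) (r : ℝ), 0 < r → μ.withDensity f (ball x r) ≠ ⊤) :
    ∀ᵐ x ∂μ, ∀ t : ℝ≥0∞, t < f x → ∀ᶠ r in 𝓝[>] (0 : ℝ),
      t * μ (ball x r) ≤ c_d * μ.withDensity f (ball x r) := by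
  have := locFinite_of_ball μ hfin
  have := locFinite_of_ball (μ.withDensity f) hνfin
  have : IsUnifLocDoublingMeasure μ := by
    refine ⟨⟨c_d * c_d, ?_⟩⟩
    filter_upwards [self_mem_nhdsWithin] with r (hr : 0 < r) x
    calc μ (closedBall x (2 * r)) ≤ μ (ball x (2 * (2 * r))) :=
          measure_mono (closedBall_subset_ball (by linarith))
      _ ≤ c_d * μ (ball x (2 * r)) := hdb x _ (by positivity)
      _ ≤ c_d * (c_d * μ (ball x r)) := by gcongr; exact hdb x _ hr
      _ ≤ c_d * (c_d * μ (closedBall x r)) := by gcongr; exact ball_subset_closedBall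
      _ = _ := by push_cast; ring
  filter_upwards [(IsUnifLocDoublingMeasure.vitaliFamily μ 1).ae_tendsto_rnDeriv (μ.withDensity f),
    Measure.rnDeriv_withDensity μ hf] with x hx hx2 t ht
  rw [hx2] at hx
  have h1 : Tendsto (fun r : ℝ => r / 2) (𝓝[>] (0 : ℝ)) (𝓝[>] 0) := by
    refine tendsto_nhdsWithin_iff.2 ⟨?_, ?_⟩
    · have : Tendsto (fun r : ℝ => r / 2) (𝓝 0) (𝓝 (0 / 2)) :=
        (continuous_id.div_const 2).tendsto 0
      rw [zero_div] at this
      exact this.mono_left nhdsWithin_le_nhds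
    · filter_upwards [self_mem_nhdsWithin] with r (hr : 0 < r)
      exact half_pos hr
  have h2 := IsUnifLocDoublingMeasure.tendsto_closedBall_filterAt μ (K := 1) (x := x)
    (fun _ : ℝ => x) (fun r : ℝ => r / 2) h1 (by
      filter_upwards [self_mem_nhdsWithin] with r (hr : 0 < r)
      exact mem_closedBall_self (by linarith))
  filter_upwards [(hx.comp h2).eventually (lt_mem_nhds ht), self_mem_nhdsWithin]
    with r hr (hr0 : 0 < r)
  simp only [Function.comp] at hr
  have hr' : t * μ (closedBall x (r / 2)) ≤ μ.withDensity f (closedBall x (r / 2)) :=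
    (ENNReal.le_div_iff_mul_le (Or.inl (ne_of_gt (lt_of_lt_of_le
      (pos_iff_ne_zero.2 (hpos x (r/2) (by positivity)))
      (measure_mono ball_subset_closedBall))))
      (Or.inl (ne_top_of_le_ne_top (hfin x r hr0)
        (measure_mono (closedBall_subset_ball (by linarith)))))).1 hr.le
  calc t * μ (ball x r) = t * μ (ball x (2 * (r / 2))) := by congr 3; ring
    _ ≤ t * (c_d * μ (ball x (r / 2))) := by gcongr; exact hdb x _ (by positivity)
    _ ≤ t * (c_d * μ (closedBall x (r / 2))) := by gcongr; exact ball_subset_closedBall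
    _ = c_d * (t * μ (closedBall x (r / 2))) := by ring
    _ ≤ c_d * μ.withDensity f (closedBall x (r / 2)) := by gcongr
    _ ≤ c_d * μ.withDensity f (ball x r) := by
      gcongr; exact closedBall_subset_ball (by linarith)

end ApAux

namespace ApAux
open Set Filter Topology

/-- One-ball estimate. -/
lemma one_ball {X : Type*} [MeasurableSpace X] (μ : Measure X)
    (f : X → ℝ≥0∞) (hf : Measurable f) (B : Set X) (hB : MeasurableSet B)
    (hBfin : μ B ≠ ⊤) (hνB : μ.withDensity f B ≠ ⊤) (c K l l' : ℝ≥0)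
    (hl : 0 < l') (hll : 4 * c * K * l ≤ l')
    (hK : ∀ F ⊆ B, MeasurableSet F → μ B ≤ (2 : ℝ≥0) * μ F →
      μ.withDensity f B ≤ K * μ.withDensity f F)
    (h1 : 2 * K * l * μ B ≤ μ.withDensity f B)
    (h2 : μ.withDensity f B ≤ c * (2 * K * l * μ B)) :
    μ.withDensity f B ≤ 2 * K * μ.withDensity f (B ∩ {x | (l : ℝ≥0∞) < f x ∧ f x ≤ l'}) := by
  set ν := μ.withDensity f with hν
  have mle : ∀ a : ℝ≥0∞, MeasurableSet {x | f x ≤ a} := fun a => measurableSet_le hf measurable_const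
  have mlt : ∀ a : ℝ≥0∞, MeasurableSet {x | a < f x} := fun a => measurableSet_lt measurable_const hf
  have hcheb : (l' : ℝ≥0∞) * μ (B ∩ {x | (l' : ℝ≥0∞) < f x}) ≤ ν B := by
    calc (l' : ℝ≥0∞) * μ (B ∩ {x | (l' : ℝ≥0∞) < f x})
        = ∫⁻ x in B ∩ {x | (l' : ℝ≥0∞) < f x}, (l' : ℝ≥0∞) ∂μ := by
          rw [setLIntegral_const]
      _ ≤ ∫⁻ x in B ∩ {x | (l' : ℝ≥0∞) < f x}, f x ∂μ :=
          setLIntegral_mono hf (fun x hx => hx.2.le)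
      _ = ν (B ∩ {x | (l' : ℝ≥0∞) < f x}) := by
          rw [hν, withDensity_apply _ (hB.inter (mlt _))]
      _ ≤ ν B := measure_mono inter_subset_left
  have hsplit : μ B = μ (B ∩ {x | f x ≤ l'}) + μ (B ∩ {x | (l' : ℝ≥0∞) < f x}) := by
    rw [← measure_inter_add_sdiff B (mle l')]
    congr 2
    ext x; simp
  have hhalf : 2 * μ (B ∩ {x | (l' : ℝ≥0∞) < f x}) ≤ μ B := by
    have h3 : (l' : ℝ≥0∞) * (2 * μ (B ∩ {x | (l' : ℝ≥0∞) < f x})) ≤ l' * μ B := by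
      calc (l' : ℝ≥0∞) * (2 * μ (B ∩ {x | (l' : ℝ≥0∞) < f x}))
          = 2 * ((l' : ℝ≥0∞) * (μ (B ∩ {x | (l' : ℝ≥0∞) < f x}))) := by ring
        _ ≤ 2 * (c * (2 * K * l * μ B)) := by exact mul_le_mul_right (hcheb.trans h2) _
        _ = ((4 * c * K * l : ℝ≥0) : ℝ≥0∞) * μ B := by push_cast; ring
        _ ≤ l' * μ B := by gcongr
    exact (ENNReal.mul_le_mul_iff_right (by exact_mod_cast hl.ne') ENNReal.coe_ne_top).1 h3
  have hF : μ B ≤ (2 : ℝ≥0) * μ (B ∩ {x | f x ≤ l'}) := by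
    have h4 : μ (B ∩ {x | (l' : ℝ≥0∞) < f x}) ≠ ⊤ :=
      ne_top_of_le_ne_top hBfin (measure_mono inter_subset_left)
    have h5 : μ (B ∩ {x | f x ≤ l'}) ≠ ⊤ :=
      ne_top_of_le_ne_top hBfin (measure_mono inter_subset_left)
    rw [hsplit] at hhalf ⊢
    lift μ (B ∩ {x | (l' : ℝ≥0∞) < f x}) to ℝ≥0 using h4 with a
    lift μ (B ∩ {x | f x ≤ l'}) to ℝ≥0 using h5 with b
    norm_cast at hhalf ⊢
    have : (2 : ℝ) * a ≤ b + a := by exact_mod_cast hhalf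
    have : (b : ℝ) + a ≤ 2 * b := by linarith
    exact_mod_cast this
  have h6 := hK _ inter_subset_left (hB.inter (mle l')) hF
  have h7 : ν (B ∩ {x | f x ≤ l'}) ≤
      l * μ B + ν (B ∩ {x | (l : ℝ≥0∞) < f x ∧ f x ≤ l'}) := by
    have hsub : B ∩ {x | f x ≤ l'} ⊆
        (B ∩ {x | f x ≤ l}) ∪ (B ∩ {x | (l : ℝ≥0∞) < f x ∧ f x ≤ l'}) := by
      rintro x ⟨hx, hx2⟩
      rcases le_or_gt (f x) l with h | h
      · exact Or.inl ⟨hx, h⟩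
      · exact Or.inr ⟨hx, h, hx2⟩
    refine (measure_mono hsub).trans ((measure_union_le _ _).trans ?_)
    gcongr
    calc ν (B ∩ {x | f x ≤ l}) = ∫⁻ x in B ∩ {x | f x ≤ l}, f x ∂μ := by
          rw [hν, withDensity_apply _ (hB.inter (mle _))]
      _ ≤ ∫⁻ x in B ∩ {x | f x ≤ l}, l ∂μ := setLIntegral_mono measurable_const (fun x hx => hx.2)
      _ = l * μ (B ∩ {x | f x ≤ l}) := by rw [setLIntegral_const]
      _ ≤ l * μ B := by gcongr; exact inter_subset_left
  set G := ν (B ∩ {x | (l : ℝ≥0∞) < f x ∧ f x ≤ l'}) with hG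
  have hGfin : G ≠ ⊤ := ne_top_of_le_ne_top hνB (measure_mono inter_subset_left)
  have h8 : ν B ≤ K * (l * μ B + G) := h6.trans (by gcongr)
  lift G to ℝ≥0 using hGfin with g
  lift ν B to ℝ≥0 using hνB with b
  lift μ B to ℝ≥0 using hBfin with m
  norm_cast at h1 h8 ⊢
  have h1' : (2 : ℝ) * K * l * m ≤ b := by exact_mod_cast h1
  have h8' : (b : ℝ) ≤ K * (l * m + g) := by exact_mod_cast h8
  have : (b : ℝ) ≤ 2 * K * g := by nlinarith
  exact_mod_cast this

lemma good_ball {X : Type*} [MetricSpace X] [MeasurableSpace X] (μ ν : Measure X)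
    (c : ℝ≥0) (hdb : IsDoublingMeasure μ c) (x : X) (δ : ℝ) (hδ : 0 < δ) (t : ℝ≥0∞)
    (hstart : ν (ball x δ) ≤ t * μ (ball x δ))
    (hsmall : ∀ᶠ r in 𝓝[>] (0 : ℝ), t * μ (ball x r) < ν (ball x r)) :
    ∃ r, 0 < r ∧ r ≤ δ ∧ t * μ (ball x r) ≤ ν (ball x r) ∧
      ν (ball x r) ≤ c * (t * μ (ball x r)) := by
  classical
  have hlim : Tendsto (fun n : ℕ => δ * (1 / 2) ^ n) atTop (𝓝[>] 0) := by
    refine tendsto_nhdsWithin_iff.2 ⟨?_, ?_⟩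
    · simpa using (tendsto_pow_atTop_nhds_zero_of_lt_one (r := (1 / 2 : ℝ)) (by norm_num)
        (by norm_num)).const_mul δ
    · exact Eventually.of_forall fun n => by simp only [mem_Ioi]; positivity
  have hex : ∃ n : ℕ, t * μ (ball x (δ * (1 / 2) ^ n)) < ν (ball x (δ * (1 / 2) ^ n)) :=
    (hlim.eventually hsmall).exists
  have hsp := Nat.find_spec hex
  rcases hn : Nat.find hex with _ | n
  · rw [hn] at hsp
    simp only [pow_zero, mul_one] at hsp
    exact absurd hstart (not_le.2 hsp)
  · rw [hn] at hsp
    have hmin := Nat.find_min hex (m := n) (by omega)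
    refine ⟨δ * (1 / 2) ^ (n + 1), by positivity, ?_, hsp.le, ?_⟩
    · exact mul_le_of_le_one_right hδ.le (pow_le_one₀ (by norm_num) (by norm_num))
    · have h2 : δ * (1 / 2) ^ n = 2 * (δ * (1 / 2) ^ (n + 1)) := by rw [pow_succ]; ring
      have hd := hdb x (δ * (1 / 2) ^ (n + 1)) (by positivity)
      rw [← h2] at hd
      calc ν (ball x (δ * (1 / 2) ^ (n + 1))) ≤ ν (ball x (δ * (1 / 2) ^ n)) := by
            refine measure_mono (ball_subset_ball ?_)
            rw [h2]; nlinarith [show 0 < δ * (1 / 2) ^ (n + 1) by positivity]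
        _ ≤ t * μ (ball x (δ * (1 / 2) ^ n)) := not_lt.1 hmin
        _ ≤ t * (c * μ (ball x (δ * (1 / 2) ^ (n + 1)))) := by gcongr
        _ = _ := by ring

/-- One step of the level set decay. -/
lemma step {X : Type*} [MetricSpace X] [MeasurableSpace X]
    [BorelSpace X] [SecondCountableTopology X] (μ : Measure X) [SigmaFinite μ]
    (hpos : ∀ (x : X) (r : ℝ), 0 < r → μ (ball x r) ≠ 0)
    (hfin : ∀ (x : X) (r : ℝ), 0 < r → μ (ball x r) ≠ ⊤)
    (c : ℝ≥0) (hc : 1 ≤ c) (hdb : IsDoublingMeasure μ c)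
    (f : X → ℝ≥0∞) (hf : Measurable f)
    (hνfin : ∀ (x : X) (r : ℝ), 0 < r → μ.withDensity f (ball x r) ≠ ⊤)
    (K K2 : ℝ≥0) (hK1 : 1 ≤ K)
    (hK : ∀ (x : X) (r : ℝ), 0 < r → ∀ F ⊆ ball x r, MeasurableSet F →
      μ (ball x r) ≤ (2 : ℝ≥0) * μ F → μ.withDensity f (ball x r) ≤ K * μ.withDensity f F)
    (hK2 : ∀ (x : X) (r : ℝ), 0 < r →
      μ.withDensity f (ball x (8 * r)) ≤ K2 * μ.withDensity f (ball x r))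
    (x0 : X) (ρ δ : ℝ) (hρ : 0 < ρ) (hδ : 0 < δ) (l l' : ℝ≥0)
    (hl : 0 < l) (hll : 4 * c * K * l ≤ l')
    (hstart : ∀ x ∈ ball x0 ρ,
      μ.withDensity f (ball x δ) ≤ 2 * K * l * μ (ball x δ)) :
    (1 + 2 * K * K2) * μ.withDensity f (ball x0 ρ ∩ {x | (l' : ℝ≥0∞) < f x}) ≤
      2 * K * K2 * μ.withDensity f (ball x0 (ρ + δ) ∩ {x | (l : ℝ≥0∞) < f x}) := by
  set ν := μ.withDensity f with hν
  have mle : ∀ a : ℝ≥0∞, MeasurableSet {x | f x ≤ a} := fun a => measurableSet_le hf measurable_const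
  have mlt : ∀ a : ℝ≥0∞, MeasurableSet {x | a < f x} := fun a => measurableSet_lt measurable_const hf
  have hl' : 0 < l' := by
    refine lt_of_lt_of_le ?_ hll
    have : 0 < c := by positivity
    have : 0 < K := by positivity
    positivity
  have hc0 : (c : ℝ≥0∞) ≠ 0 := by
    have : 0 < c := by positivity
    exact_mod_cast this.ne'
  have hll' : l ≤ l' := by
    refine le_trans ?_ hll
    have h1 : (1 : ℝ≥0) ≤ 4 * c * K := by
      have : (1 : ℝ≥0) ≤ c * K := one_le_mul_of_one_le_of_one_le hc hK1
      calc (1 : ℝ≥0) ≤ 4 * (c * K) := one_le_mul_of_one_le_of_one_le (by norm_num) this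
        _ = _ := by ring
    exact le_mul_of_one_le_left (by positivity) h1
  have hleb := lebesgue μ hpos hfin c hdb f hf hνfin
  have hleb' : ∀ᵐ x ∂ν, ∀ t : ℝ≥0∞, t < f x → ∀ᶠ r in 𝓝[>] (0 : ℝ),
      t * μ (ball x r) ≤ c * ν (ball x r) :=
    (withDensity_absolutelyContinuous μ f).ae_le hleb
  set E := ball x0 ρ ∩ {x | (l' : ℝ≥0∞) < f x} with hE
  set t : Set X := {x | x ∈ E ∧ ∀ t : ℝ≥0∞, t < f x → ∀ᶠ r in 𝓝[>] (0 : ℝ),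
      t * μ (ball x r) ≤ c * ν (ball x r)} with ht
  have hEt : ν E ≤ ν t := by
    refine measure_mono_ae ?_
    filter_upwards [hleb'] with x hx hxE
    exact ⟨hxE, hx⟩
  have hex : ∀ x ∈ t, ∃ r, 0 < r ∧ r ≤ δ ∧ 2 * K * l * μ (ball x r) ≤ ν (ball x r) ∧
      ν (ball x r) ≤ c * (2 * K * l * μ (ball x r)) := by
    intro x hx
    refine good_ball μ ν c hdb x δ hδ _ (hstart x hx.1.1) ?_
    filter_upwards [hx.2 l' hx.1.2, self_mem_nhdsWithin] with r hr (hr0 : 0 < r)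
    have h3 : (c : ℝ≥0∞) * (2 * K * l * μ (ball x r)) < l' * μ (ball x r) := by
      calc (c : ℝ≥0∞) * (2 * K * l * μ (ball x r)) = ((2 * c * K * l : ℝ≥0) : ℝ≥0∞) * μ (ball x r) := by
            push_cast; ring
        _ < l' * μ (ball x r) := by
            refine ENNReal.mul_lt_mul_left (hpos x r hr0) (hfin x r hr0) ?_
            have : 2 * c * K * l < 4 * c * K * l := by
              have : 0 < c := by positivity
              have : 0 < K := by positivity
              have h0 : 0 < c * K * l := by positivity
              calc 2 * c * K * l = 2 * (c * K * l) := by ring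
                _ < 4 * (c * K * l) := by gcongr; norm_num
                _ = _ := by ring
            exact_mod_cast this.trans_le hll
    exact (ENNReal.mul_lt_mul_iff_right hc0 ENNReal.coe_ne_top).1 (h3.trans_le hr)
  choose! r hr0 hrδ hr1 hr2 using hex
  obtain ⟨u, hut, hdis, hcov⟩ := Vitali.exists_disjoint_subfamily_covering_enlargement_closedBall
    t id r δ hrδ 5 (by norm_num)
  have hdis' : u.PairwiseDisjoint fun a => ball a (r a) := fun a ha b hb hab =>
    (hdis ha hb hab).mono ball_subset_closedBall ball_subset_closedBall
  have hucount : u.Countable := hdis'.countable_of_isOpen (fun a _ => isOpen_ball)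
    (fun a ha => ⟨a, mem_ball_self (hr0 a (hut ha))⟩)
  have hcov' : t ⊆ ⋃ a ∈ u, ball a (8 * r a) := by
    intro x hx
    obtain ⟨b, hb, hs⟩ := hcov x hx
    have h1 := hs (mem_closedBall_self (hr0 x hx).le)
    refine mem_iUnion₂.2 ⟨b, hb, ?_⟩
    exact closedBall_subset_ball (by nlinarith [hr0 b (hut hb)]) h1
  set G : X → Set X := fun a => ball a (r a) ∩ {x | (l : ℝ≥0∞) < f x ∧ f x ≤ l'} with hG
  have hGm : ∀ a, MeasurableSet (G a) := fun a =>
    measurableSet_ball.inter ((mlt l).inter (mle l'))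
  have hsum : ν E ≤ 2 * K * K2 * ν (⋃ a ∈ u, G a) := by
    calc ν E ≤ ν (⋃ a ∈ u, ball a (8 * r a)) := hEt.trans (measure_mono hcov')
      _ ≤ ∑' a : u, ν (ball (a : X) (8 * r a)) := measure_biUnion_le ν hucount _
      _ ≤ ∑' a : u, 2 * K * K2 * ν (G a) := by
          refine ENNReal.tsum_le_tsum fun a => ?_
          have ha := hut a.2
          calc ν (ball (a : X) (8 * r a)) ≤ K2 * ν (ball (a : X) (r a)) := hK2 _ _ (hr0 _ ha)
            _ ≤ K2 * (2 * K * ν (G a)) := by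
                gcongr
                exact one_ball μ f hf _ measurableSet_ball (hfin _ _ (hr0 _ ha))
                  (hνfin _ _ (hr0 _ ha)) c K l l' hl' hll (hK _ _ (hr0 _ ha)) (hr1 _ ha) (hr2 _ ha)
            _ = _ := by ring
      _ = 2 * K * K2 * ν (⋃ a ∈ u, G a) := by
          rw [ENNReal.tsum_mul_left, measure_biUnion hucount ?_ (fun a _ => hGm a)]
          exact fun a ha b hb hab => (hdis' ha hb hab).mono inter_subset_left inter_subset_left
  have hdisj : Disjoint (⋃ a ∈ u, G a) E := by
    refine disjoint_left.2 fun x hx hxE => ?_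
    obtain ⟨a, ha, hxa⟩ := mem_iUnion₂.1 hx
    exact absurd hxE.2 (not_lt.2 hxa.2.2)
  have hunion : (⋃ a ∈ u, G a) ∪ E ⊆ ball x0 (ρ + δ) ∩ {x | (l : ℝ≥0∞) < f x} := by
    rintro x (hx | hx)
    · obtain ⟨a, ha, hxa⟩ := mem_iUnion₂.1 hx
      refine ⟨?_, hxa.2.1⟩
      have h1 : dist x a < r a := hxa.1
      have h2 : dist a x0 < ρ := (hut ha).1.1
      have h3 := hrδ a (hut ha)
      have := dist_triangle x a x0
      rw [mem_ball]; linarith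
    · exact ⟨ball_subset_ball (by linarith) hx.1, lt_of_le_of_lt (ENNReal.coe_le_coe.2 hll') hx.2⟩
  have hadd : ν (⋃ a ∈ u, G a) + ν E ≤ ν (ball x0 (ρ + δ) ∩ {x | (l : ℝ≥0∞) < f x}) := by
    rw [← measure_union hdisj (measurableSet_ball.inter (mlt _))]
    exact measure_mono hunion
  calc (1 + 2 * K * K2) * ν E = ν E + 2 * K * K2 * ν E := by ring
    _ ≤ 2 * K * K2 * ν (⋃ a ∈ u, G a) + 2 * K * K2 * ν E := by gcongr
    _ = 2 * K * K2 * (ν (⋃ a ∈ u, G a) + ν E) := by ring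
    _ ≤ _ := by gcongr

end ApAux

namespace ApAux
open Set Filter Topology

lemma doubling_pow {X : Type*} [MetricSpace X] [MeasurableSpace X] (μ : Measure X)
    (c : ℝ≥0) (hdb : IsDoublingMeasure μ c) (x : X) (r : ℝ) (hr : 0 < r) (n : ℕ) :
    μ (ball x (2 ^ n * r)) ≤ (c : ℝ≥0∞) ^ n * μ (ball x r) := by
  induction n with
  | zero => simp
  | succ n ih =>
    calc μ (ball x (2 ^ (n + 1) * r)) = μ (ball x (2 * (2 ^ n * r))) := by
          congr 2; ring
      _ ≤ c * μ (ball x (2 ^ n * r)) := hdb x _ (by positivity)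
      _ ≤ c * ((c : ℝ≥0∞) ^ n * μ (ball x r)) := by gcongr
      _ = _ := by ring

lemma exists_eps (A θ : ℝ≥0) (hA : 0 < A) (hθ : θ < 1) : ∃ ε : ℝ, 0 < ε ∧ A ^ ε * θ < 1 := by
  have hc : Continuous (fun e : ℝ => (A : ℝ) ^ e * θ) :=
    (Real.continuous_const_rpow (by exact_mod_cast hA.ne')).mul continuous_const
  have h0 : (fun e : ℝ => (A : ℝ) ^ e * θ) 0 < 1 := by simpa using hθ
  have h1 := (hc.tendsto 0).eventually (gt_mem_nhds h0)
  have h2 := h1.filter_mono (nhdsWithin_le_nhds (s := Ioi 0))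
  obtain ⟨e, he, he0⟩ := (h2.and self_mem_nhdsWithin).exists
  exact ⟨e, he0, by exact_mod_cast he⟩

/-- Pointwise layer bound. -/
lemma layer (A l0 : ℝ≥0) (hA : 1 < A) (hl0 : 0 < l0) (ε : ℝ) (hε : 0 < ε) (a : ℝ≥0∞)
    (ha : a ≠ ⊤) :
    a ^ ε ≤ (l0 : ℝ≥0∞) ^ ε + ∑' k : ℕ, ((A ^ (k + 1) * l0 : ℝ≥0) : ℝ≥0∞) ^ ε *
      ({b : ℝ≥0∞ | ((A ^ k * l0 : ℝ≥0) : ℝ≥0∞) < b}.indicator 1 a) := by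
  classical
  lift a to ℝ≥0 using ha
  have hex : ∃ n : ℕ, a ≤ A ^ n * l0 := by
    obtain ⟨n, hn⟩ := pow_unbounded_of_one_lt (a / l0) hA
    exact ⟨n, ((div_le_iff₀ hl0).1 hn.le)⟩
  have hsp := Nat.find_spec hex
  rcases hn : Nat.find hex with _ | n
  · rw [hn] at hsp
    refine le_add_right (ENNReal.rpow_le_rpow ?_ hε.le)
    simp only [pow_zero, one_mul] at hsp
    exact_mod_cast hsp
  · rw [hn] at hsp
    have hmin := not_le.1 (Nat.find_min hex (m := n) (by omega))
    refine le_add_left (le_trans ?_ (ENNReal.le_tsum n))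
    rw [indicator_of_mem (by exact ENNReal.coe_lt_coe.2 hmin), Pi.one_apply, mul_one]
    exact ENNReal.rpow_le_rpow (by exact_mod_cast hsp) hε.le

lemma decay {X : Type*} [MetricSpace X] [MeasurableSpace X]
    [BorelSpace X] [SecondCountableTopology X] (μ : Measure X) [SigmaFinite μ]
    (hpos : ∀ (x : X) (r : ℝ), 0 < r → μ (ball x r) ≠ 0)
    (hfin : ∀ (x : X) (r : ℝ), 0 < r → μ (ball x r) ≠ ⊤)
    (c : ℝ≥0) (hc : 1 ≤ c) (hdb : IsDoublingMeasure μ c)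
    (f : X → ℝ≥0∞) (hf : Measurable f)
    (hνfin : ∀ (x : X) (r : ℝ), 0 < r → μ.withDensity f (ball x r) ≠ ⊤)
    (K K2 : ℝ≥0) (hK1 : 1 ≤ K)
    (hK : ∀ (x : X) (r : ℝ), 0 < r → ∀ F ⊆ ball x r, MeasurableSet F →
      μ (ball x r) ≤ (2 : ℝ≥0) * μ F → μ.withDensity f (ball x r) ≤ K * μ.withDensity f F)
    (hK2 : ∀ (x : X) (r : ℝ), 0 < r →
      μ.withDensity f (ball x (8 * r)) ≤ K2 * μ.withDensity f (ball x r))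
    (x0 : X) (R : ℝ) (hR : 0 < R) (m : ℝ≥0) (hm : 0 < m)
    (hm2 : μ.withDensity f (ball x0 (2 * R)) ≤ m * μ (ball x0 (2 * R))) (k : ℕ) :
    μ.withDensity f (ball x0 (R + R / 2 ^ k) ∩
      {x | (((4 * c * K) ^ k * (c ^ 3 * m) : ℝ≥0) : ℝ≥0∞) < f x}) ≤
      ((2 * K * K2 / (1 + 2 * K * K2) : ℝ≥0) : ℝ≥0∞) ^ k * μ.withDensity f (ball x0 (2 * R)) := by
  set ν := μ.withDensity f with hν
  have hcK : c ≤ 4 * c * K := by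
    calc c ≤ c * (4 * K) := le_mul_of_one_le_right (by positivity)
          (one_le_mul_of_one_le_of_one_le (by norm_num) hK1)
      _ = _ := by ring
  have hc0 : 0 < c := by positivity
  have hK0 : 0 < K := by positivity
  induction k with
  | zero =>
    simp only [pow_zero, one_mul, div_one]
    refine measure_mono (inter_subset_left.trans ?_)
    rw [two_mul]
  | succ k ih =>
    have hRk : R / 2 ^ k = R / 2 ^ (k + 1) + R / 2 ^ (k + 1) := by
      rw [pow_succ]; field_simp; norm_num
    have hRk0 : R / 2 ^ k ≤ R := div_le_self hR.le (one_le_pow₀ (by norm_num))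
    have hδ : 0 < R / 2 ^ (k + 1) := by positivity
    have hst := step μ hpos hfin c hc hdb f hf hνfin K K2 hK1 hK hK2 x0 (R + R / 2 ^ (k + 1))
      (R / 2 ^ (k + 1)) (by positivity) hδ ((4 * c * K) ^ k * (c ^ 3 * m))
      ((4 * c * K) ^ (k + 1) * (c ^ 3 * m)) (by positivity) (by rw [pow_succ]; apply le_of_eq; ring) ?_
    · rw [show R + R / 2 ^ (k + 1) + R / 2 ^ (k + 1) = R + R / 2 ^ k by rw [hRk]; ring] at hst
      set N : ℝ≥0 := 2 * K * K2 with hN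
      have hN1 : ((1 + N : ℝ≥0) : ℝ≥0∞) ≠ 0 := by
        have : (0 : ℝ≥0) < 1 + N := by positivity
        exact_mod_cast this.ne'
      rw [← ENNReal.mul_le_mul_iff_right hN1 ENNReal.coe_ne_top]
      calc ((1 + N : ℝ≥0) : ℝ≥0∞) * ν (ball x0 (R + R / 2 ^ (k + 1)) ∩
            {x | (((4 * c * K) ^ (k + 1) * (c ^ 3 * m) : ℝ≥0) : ℝ≥0∞) < f x})
          ≤ N * ν (ball x0 (R + R / 2 ^ k) ∩
            {x | (((4 * c * K) ^ k * (c ^ 3 * m) : ℝ≥0) : ℝ≥0∞) < f x}) := by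
            simp only [hN]
            push_cast at hst ⊢
            exact hst
        _ ≤ N * (((N / (1 + N) : ℝ≥0) : ℝ≥0∞) ^ k * ν (ball x0 (2 * R))) := by gcongr
        _ = ((1 + N : ℝ≥0) : ℝ≥0∞) * (((N / (1 + N) : ℝ≥0) : ℝ≥0∞) ^ (k + 1) * ν (ball x0 (2 * R))) := by
            have : (1 + N) * (N / (1 + N)) = N := mul_div_cancel₀ _ (by positivity)
            rw [pow_succ]
            nth_rewrite 1 [← this]
            push_cast
            ring
    · intro x hx
      have hx' : dist x x0 < R + R / 2 ^ (k + 1) := hx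
      calc ν (ball x (R / 2 ^ (k + 1))) ≤ ν (ball x0 (2 * R)) :=
            measure_mono (ball_subset_ball' (by linarith))
        _ ≤ m * μ (ball x0 (2 * R)) := hm2
        _ ≤ m * μ (ball x (2 ^ (k + 3) * (R / 2 ^ (k + 1)))) := by
            gcongr
            have : 2 ^ (k + 3) * (R / 2 ^ (k + 1)) = 4 * R := by
              rw [pow_add, pow_add]; field_simp; norm_num
            rw [this]
            refine ball_subset_ball' ?_
            rw [dist_comm]; linarith
        _ ≤ m * ((c : ℝ≥0∞) ^ (k + 3) * μ (ball x (R / 2 ^ (k + 1)))) := by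
            gcongr; exact doubling_pow μ c hdb x _ hδ _
        _ = ((c ^ k * (c ^ 3 * m) : ℝ≥0) : ℝ≥0∞) * μ (ball x (R / 2 ^ (k + 1))) := by
            push_cast; ring
        _ ≤ ((2 * K * ((4 * c * K) ^ k * (c ^ 3 * m)) : ℝ≥0) : ℝ≥0∞) * μ (ball x (R / 2 ^ (k + 1))) := by
            have hh : c ^ k * (c ^ 3 * m) ≤ 2 * K * ((4 * c * K) ^ k * (c ^ 3 * m)) :=
              calc c ^ k * (c ^ 3 * m) ≤ (4 * c * K) ^ k * (c ^ 3 * m) := by gcongr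
                _ ≤ 2 * K * ((4 * c * K) ^ k * (c ^ 3 * m)) := le_mul_of_one_le_left (by positivity)
                  (one_le_mul_of_one_le_of_one_le (by norm_num) hK1)
            exact mul_le_mul_left (ENNReal.coe_le_coe.2 hh) _
        _ = _ := by push_cast; ring

lemma rev_holder {X : Type*} [MetricSpace X] [MeasurableSpace X]
    [BorelSpace X] [SecondCountableTopology X] (μ : Measure X) [SigmaFinite μ]
    (hpos : ∀ (x : X) (r : ℝ), 0 < r → μ (ball x r) ≠ 0)
    (hfin : ∀ (x : X) (r : ℝ), 0 < r → μ (ball x r) ≠ ⊤)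
    (c : ℝ≥0) (hc : 1 ≤ c) (hdb : IsDoublingMeasure μ c)
    (f : X → ℝ≥0∞) (hf : Measurable f) (hft : ∀ x, f x ≠ ⊤)
    (hνpos : ∀ (x : X) (r : ℝ), 0 < r → μ.withDensity f (ball x r) ≠ 0)
    (hνfin : ∀ (x : X) (r : ℝ), 0 < r → μ.withDensity f (ball x r) ≠ ⊤)
    (H : ∀ M : ℝ≥0, ∃ K : ℝ≥0, ∀ (x : X) (r : ℝ), 0 < r → ∀ F ⊆ ball x r, MeasurableSet F →
      μ (ball x r) ≤ M * μ F → μ.withDensity f (ball x r) ≤ K * μ.withDensity f F) :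
    ∃ ε : ℝ, 0 < ε ∧ ∃ C : ℝ≥0, ∀ (x : X) (R : ℝ), 0 < R →
      ∫⁻ y in ball x R, f y ^ (1 + ε) ∂μ ≤
        C * (μ.withDensity f (ball x (2 * R)) / μ (ball x (2 * R))) ^ ε *
          μ.withDensity f (ball x (2 * R)) := by
  obtain ⟨K', hK'⟩ := H 2
  obtain ⟨K2, hK2'⟩ := H (c ^ 3)
  set ν := μ.withDensity f with hν
  set K := max 1 K' with hKdef
  have hK1 : 1 ≤ K := le_max_left _ _
  have hK : ∀ (x : X) (r : ℝ), 0 < r → ∀ F ⊆ ball x r, MeasurableSet F →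
      μ (ball x r) ≤ (2 : ℝ≥0) * μ F → ν (ball x r) ≤ K * ν F := by
    intro x r hr F hF hFm h
    refine (hK' x r hr F hF hFm h).trans ?_
    gcongr
    exact le_max_right _ _
  have hK2 : ∀ (x : X) (r : ℝ), 0 < r → ν (ball x (8 * r)) ≤ K2 * ν (ball x r) := by
    intro x r hr
    refine hK2' x (8 * r) (by positivity) _ (ball_subset_ball (by linarith)) measurableSet_ball ?_
    have := doubling_pow μ c hdb x r hr 3
    norm_num at this ⊢
    exact this
  set A : ℝ≥0 := 4 * c * K with hAdef
  have hA : 1 < A := by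
    have : 1 ≤ c * K := one_le_mul_of_one_le_of_one_le hc hK1
    calc (1 : ℝ≥0) < 4 := by norm_num
      _ ≤ 4 * (c * K) := le_mul_of_one_le_right (by positivity) this
      _ = A := by rw [hAdef]; ring
  set θ : ℝ≥0 := 2 * K * K2 / (1 + 2 * K * K2) with hθdef
  have hθ : θ < 1 := by
    rw [hθdef, div_lt_one (by positivity)]
    exact lt_add_of_pos_left _ one_pos
  obtain ⟨ε, hε, hq⟩ := exists_eps A θ (by positivity) hθ
  set q : ℝ≥0 := A ^ ε * θ with hqdef
  refine ⟨ε, hε, (c ^ 3) ^ ε * (1 + A ^ ε * (1 - q)⁻¹), fun x0 R hR => ?_⟩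
  have h2R : 0 < 2 * R := by positivity
  have havg_top : ν (ball x0 (2 * R)) / μ (ball x0 (2 * R)) ≠ ⊤ :=
    ENNReal.div_ne_top (hνfin _ _ h2R) (hpos _ _ h2R)
  have havg_pos : ν (ball x0 (2 * R)) / μ (ball x0 (2 * R)) ≠ 0 :=
    ENNReal.div_ne_zero.2 ⟨hνpos _ _ h2R, hfin _ _ h2R⟩
  have hm2' : ν (ball x0 (2 * R)) = ν (ball x0 (2 * R)) / μ (ball x0 (2 * R)) * μ (ball x0 (2 * R)) :=
    (ENNReal.div_mul_cancel (hpos _ _ h2R) (hfin _ _ h2R)).symm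
  generalize hav : ν (ball x0 (2 * R)) / μ (ball x0 (2 * R)) = av at *
  lift av to ℝ≥0 using havg_top with m
  have hm : 0 < m := pos_iff_ne_zero.2 (by exact_mod_cast havg_pos)
  have hdec := decay μ hpos hfin c hc hdb f hf hνfin K K2 hK1 hK hK2 x0 R hR m hm hm2'.le
  set l0 : ℝ≥0 := c ^ 3 * m with hl0def
  have hl0 : 0 < l0 := by positivity
  have hmeas : ∀ k : ℕ, MeasurableSet {x | ((A ^ k * l0 : ℝ≥0) : ℝ≥0∞) < f x} := fun k =>
    measurableSet_lt measurable_const hf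
  have hle : ∀ y, f y ^ ε ≤ (l0 : ℝ≥0∞) ^ ε + ∑' k : ℕ, ((A ^ (k + 1) * l0 : ℝ≥0) : ℝ≥0∞) ^ ε *
      ({x | ((A ^ k * l0 : ℝ≥0) : ℝ≥0∞) < f x}.indicator 1 y) := fun y =>
    layer A l0 hA hl0 ε hε (f y) (hft y)
  have hterm : ∀ k : ℕ, ((A ^ (k + 1) * l0 : ℝ≥0) : ℝ≥0∞) ^ ε =
      (l0 : ℝ≥0∞) ^ ε * ((A ^ ε : ℝ≥0) : ℝ≥0∞) * ((A ^ ε : ℝ≥0) : ℝ≥0∞) ^ k := by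
    intro k
    rw [ENNReal.coe_mul, ENNReal.mul_rpow_of_nonneg _ _ hε.le, ENNReal.coe_pow,
      ENNReal.coe_rpow_of_nonneg _ hε.le, ← ENNReal.rpow_natCast_mul, mul_comm ((k + 1 : ℕ) : ℝ) ε,
      ENNReal.rpow_mul_natCast, pow_succ]
    ring
  calc ∫⁻ y in ball x0 R, f y ^ (1 + ε) ∂μ = ∫⁻ y in ball x0 R, f y ^ ε ∂ν := by
        rw [hν, setLIntegral_withDensity_eq_setLIntegral_mul μ hf (hf.pow_const ε)
          measurableSet_ball]
        refine lintegral_congr fun y => ?_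
        rw [ENNReal.rpow_add_of_nonneg _ _ zero_le_one hε.le, ENNReal.rpow_one]; rfl
    _ ≤ ∫⁻ y in ball x0 R, ((l0 : ℝ≥0∞) ^ ε + ∑' k : ℕ, ((A ^ (k + 1) * l0 : ℝ≥0) : ℝ≥0∞) ^ ε *
      ({x | ((A ^ k * l0 : ℝ≥0) : ℝ≥0∞) < f x}.indicator 1 y)) ∂ν := lintegral_mono hle
    _ = (l0 : ℝ≥0∞) ^ ε * ν (ball x0 R) + ∑' k : ℕ, ((A ^ (k + 1) * l0 : ℝ≥0) : ℝ≥0∞) ^ ε *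
          ν (ball x0 R ∩ {x | ((A ^ k * l0 : ℝ≥0) : ℝ≥0∞) < f x}) := by
        rw [lintegral_add_left measurable_const, setLIntegral_const, lintegral_tsum]
        · congr 1
          refine tsum_congr fun k => ?_
          rw [lintegral_const_mul _ (measurable_one.indicator (hmeas k)),
            lintegral_indicator_one (hmeas k), Measure.restrict_apply (hmeas k), inter_comm]
        · intro k
          exact ((measurable_one.indicator (hmeas k)).const_mul _).aemeasurable
    _ ≤ (l0 : ℝ≥0∞) ^ ε * ν (ball x0 (2 * R)) + ∑' k : ℕ, ((A ^ (k + 1) * l0 : ℝ≥0) : ℝ≥0∞) ^ ε *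
          ((θ : ℝ≥0∞) ^ k * ν (ball x0 (2 * R))) := by
        gcongr with k
        · linarith
        · refine (measure_mono ?_).trans (hdec k)
          refine inter_subset_inter_left _ (ball_subset_ball ?_)
          have : 0 < R / 2 ^ k := by positivity
          linarith
    _ = (l0 : ℝ≥0∞) ^ ε * ν (ball x0 (2 * R)) *
          (1 + ((A ^ ε : ℝ≥0) : ℝ≥0∞) * ∑' k : ℕ, (q : ℝ≥0∞) ^ k) := by
        rw [mul_add, mul_one, ← mul_assoc, ← ENNReal.tsum_mul_left]
        congr 1
        refine tsum_congr fun k => ?_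
        rw [hterm, hqdef, ENNReal.coe_mul (A ^ ε) θ, mul_pow]
        ring
    _ = (l0 : ℝ≥0∞) ^ ε * ν (ball x0 (2 * R)) *
          ((1 + A ^ ε * (1 - q)⁻¹ : ℝ≥0) : ℝ≥0∞) := by
        rw [ENNReal.tsum_geometric]
        have : (1 - q) ≠ 0 := (tsub_pos_of_lt hq).ne'
        rw [ENNReal.coe_add, ENNReal.coe_mul (A ^ ε) (1 - q)⁻¹, ENNReal.coe_inv this, ENNReal.coe_sub,
          ENNReal.coe_one]
    _ = _ := by
        rw [hl0def, ENNReal.coe_mul, ENNReal.mul_rpow_of_nonneg _ _ hε.le, ENNReal.coe_mul,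
          ENNReal.coe_rpow_of_nonneg _ hε.le]
        ring

end ApAux

namespace ApAux
open Set Filter Topology

lemma exp_id (q : ℝ) (hq : q - 1 ≠ 0) : 1 - q / (q - 1) = -(1 / (q - 1)) := by
  field_simp
  ring

lemma holder_H {X : Type*} [MeasurableSpace X] (μ : Measure X)
    (f g : X → ℝ≥0∞) (hf : Measurable f) (hg : Measurable g) (p : ℝ) (hp : 1 < p)
    (hfg : ∀ y, f y ^ ((p - 1) / p) * g y ^ (1 / p) = 1) (c M : ℝ≥0) (B F : Set X)
    (hG0 : ∫⁻ y in B, g y ∂μ ≠ 0) (hGt : ∫⁻ y in B, g y ∂μ ≠ ⊤)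
    (hA : (∫⁻ y in B, g y ∂μ) * (∫⁻ y in B, f y ∂μ) ^ (p - 1) ≤ c * μ B ^ p)
    (hF : F ⊆ B) (hBF : μ B ≤ M * μ F) :
    ∫⁻ y in B, f y ∂μ ≤ ((c * M ^ p) ^ (1 / (p - 1)) : ℝ≥0) * ∫⁻ y in F, f y ∂μ := by
  have hp0 : 0 < p := by linarith
  have hp1 : 0 < p - 1 := by linarith
  have hconj : (p / (p - 1)).HolderConjugate p :=
    (Real.HolderConjugate.conjExponent hp).symm
  have hH : μ F ≤ (∫⁻ y in F, f y ∂μ) ^ ((p - 1) / p) * (∫⁻ y in B, g y ∂μ) ^ (1 / p) := by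
    have h := ENNReal.lintegral_mul_le_Lp_mul_Lq (μ.restrict F) hconj
      (hf.pow_const ((p - 1) / p)).aemeasurable (hg.pow_const (1 / p)).aemeasurable
    have e1 : ∀ y, (f y ^ ((p - 1) / p)) ^ (p / (p - 1)) = f y := fun y => by
      rw [← ENNReal.rpow_mul, div_mul_div_cancel₀ hp0.ne', div_self hp1.ne', ENNReal.rpow_one]
    have e2 : ∀ y, (g y ^ (1 / p)) ^ p = g y := fun y => by
      rw [← ENNReal.rpow_mul, one_div_mul_cancel hp0.ne', ENNReal.rpow_one]
    simp only [e1, e2, Pi.mul_apply, hfg, one_div_div] at h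
    rw [lintegral_one, Measure.restrict_apply_univ] at h
    refine h.trans ?_
    gcongr
  set a := ∫⁻ y in F, f y ∂μ
  set b := ∫⁻ y in B, f y ∂μ
  set G := ∫⁻ y in B, g y ∂μ
  have h1 : G * b ^ (p - 1) ≤ G * ((c * M ^ p : ℝ≥0) * a ^ (p - 1)) := by
    calc G * b ^ (p - 1) ≤ c * μ B ^ p := hA
      _ ≤ c * (M * (a ^ ((p - 1) / p) * G ^ (1 / p))) ^ p := by
          gcongr
          exact hBF.trans (by gcongr)
      _ = _ := by
          rw [ENNReal.mul_rpow_of_nonneg _ _ hp0.le, ENNReal.mul_rpow_of_nonneg _ _ hp0.le,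
            ← ENNReal.rpow_mul, ← ENNReal.rpow_mul, div_mul_cancel₀ _ hp0.ne',
            div_mul_cancel₀ _ hp0.ne', ENNReal.rpow_one, ENNReal.coe_mul,
            ENNReal.coe_rpow_of_nonneg _ hp0.le]
          ring
  have h2 := (ENNReal.mul_le_mul_iff_right hG0 hGt).1 h1
  have h3 := ENNReal.rpow_le_rpow h2 (one_div_pos.2 hp1).le
  rw [ENNReal.mul_rpow_of_nonneg _ _ (one_div_pos.2 hp1).le, ← ENNReal.rpow_mul,
    ← ENNReal.rpow_mul, mul_one_div_cancel hp1.ne', ENNReal.rpow_one, ENNReal.rpow_one] at h3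
  rwa [ENNReal.coe_rpow_of_nonneg _ (one_div_pos.2 hp1).le]

lemma final_real (p ε c C c_w m m2 I I2 J2 Q : ℝ) (hp : 1 < p) (hε : 0 < ε) (hc : 1 ≤ c)
    (hC : 0 ≤ C) (hm : 0 < m) (hm2 : 0 < m2) (hI : 0 ≤ I) (hJ2 : 0 ≤ J2) (hQ0 : 0 ≤ Q)
    (hmm : m2 ≤ c * m) (hII : I ≤ I2) (hA : I2 / m2 * (J2 / m2) ^ (p - 1) ≤ c_w)
    (hQ : Q ≤ C * (J2 / m2) ^ ε * J2) :
    I / m * (Q / m) ^ ((p - 1) / (1 + ε)) ≤ c * (C * c) ^ ((p - 1) / (1 + ε)) * c_w := by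
  have hc0 : 0 < c := by linarith
  have he : 0 ≤ (p - 1) / (1 + ε) := by
    have : 0 < p - 1 := by linarith
    positivity
  have hj : 0 ≤ J2 / m2 := by positivity
  have hI2 : 0 ≤ I2 := hI.trans hII
  have hinv : 1 / m ≤ c / m2 := by
    rw [div_le_div_iff₀ hm hm2]; linarith
  have h1 : I / m ≤ c * (I2 / m2) := by
    calc I / m = I * (1 / m) := by ring
      _ ≤ I2 * (c / m2) := by gcongr
      _ = _ := by ring
  have h2 : Q / m ≤ C * c * (J2 / m2) ^ (1 + ε) := by
    calc Q / m = Q * (1 / m) := by ring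
      _ ≤ (C * (J2 / m2) ^ ε * J2) * (c / m2) := by gcongr
      _ = C * c * ((J2 / m2) * (J2 / m2) ^ ε) := by ring
      _ = _ := by
        rw [Real.rpow_add_of_nonneg hj zero_le_one hε.le, Real.rpow_one]
  have h3 : (Q / m) ^ ((p - 1) / (1 + ε)) ≤
      (C * c) ^ ((p - 1) / (1 + ε)) * (J2 / m2) ^ (p - 1) := by
    calc (Q / m) ^ ((p - 1) / (1 + ε)) ≤ (C * c * (J2 / m2) ^ (1 + ε)) ^ ((p - 1) / (1 + ε)) :=
          Real.rpow_le_rpow (by positivity) h2 he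
      _ = _ := by
          rw [Real.mul_rpow (by positivity) (by positivity), ← Real.rpow_mul hj,
            mul_div_cancel₀ _ (by positivity)]
  calc I / m * (Q / m) ^ ((p - 1) / (1 + ε)) ≤
        c * (I2 / m2) * ((C * c) ^ ((p - 1) / (1 + ε)) * (J2 / m2) ^ (p - 1)) := by
        gcongr
    _ = c * (C * c) ^ ((p - 1) / (1 + ε)) * (I2 / m2 * (J2 / m2) ^ (p - 1)) := by ring
    _ ≤ _ := by gcongr

lemma isAp_congr {X : Type*} [MetricSpace X] [MeasurableSpace X] (μ : Measure X) (p c : ℝ)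
    (w v : X → ℝ) (h : w =ᵐ[μ] v) (hw : IsAp μ p c w) : IsAp μ p c v := by
  intro x r hr
  obtain ⟨h1, h2⟩ := hw x r hr
  have hr1 : w =ᵐ[μ.restrict (ball x r)] v := ae_restrict_of_ae h
  have hr2 : (fun y => w y ^ (1 - p / (p - 1))) =ᵐ[μ.restrict (ball x r)]
      (fun y => v y ^ (1 - p / (p - 1))) := by
    filter_upwards [hr1] with y hy
    simp only [hy]
  refine ⟨h1.congr hr2, ?_⟩
  rwa [← average_congr hr1, ← average_congr hr2]

lemma main_pos {X : Type*} [MetricSpace X] [MeasurableSpace X]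
    [BorelSpace X] (μ : Measure X)
    (hopen : ∀ U : Set X, IsOpen U → U.Nonempty → 0 < μ U)
    (hbdd : ∀ s : Set X, Bornology.IsBounded s → μ s < ⊤)
    (c : ℝ≥0) (hc : 1 ≤ c) (hdb : IsDoublingMeasure μ c)
    (p c_w : ℝ) (hp : 1 < p) (hcw : 0 < c_w)
    (w : X → ℝ) (hw0 : ∀ x, 0 < w x) (hwm : Measurable w)
    (hwloc : ∀ (x : X) (r : ℝ), 0 < r → IntegrableOn w (ball x r) μ)
    (hw : IsAp μ p c_w w) :
    ∃ p₁ : ℝ, 1 < p₁ ∧ p₁ < p ∧ ∃ c₁ : ℝ, 0 < c₁ ∧ IsAp μ p₁ c₁ w := by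
  have := sigmaFinite_of_bdd μ hbdd
  have := secondCountable μ hopen hbdd
  have hp0 : 0 < p := by linarith
  have hp1 : 0 < p - 1 := by linarith
  have hpos : ∀ (x : X) (r : ℝ), 0 < r → μ (ball x r) ≠ 0 := fun x r hr =>
    (hopen _ isOpen_ball ⟨x, mem_ball_self hr⟩).ne'
  have hfin : ∀ (x : X) (r : ℝ), 0 < r → μ (ball x r) ≠ ⊤ := fun x r hr =>
    (hbdd _ isBounded_ball).ne
  have hexp : 1 - p / (p - 1) = -(1 / (p - 1)) := by field_simp; ring
  set s : X → ℝ := fun y => w y ^ (1 - p / (p - 1)) with hs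
  have hs0 : ∀ y, 0 < s y := fun y => Real.rpow_pos_of_pos (hw0 y) _
  have hsm : Measurable s := hwm.pow_const _
  have hsloc : ∀ (x : X) (r : ℝ), 0 < r → IntegrableOn s (ball x r) μ := fun x r hr => (hw x r hr).1
  set f : X → ℝ≥0∞ := fun y => ENNReal.ofReal (s y) with hf
  set g : X → ℝ≥0∞ := fun y => ENNReal.ofReal (w y) with hg
  have hfm : Measurable f := hsm.ennreal_ofReal
  have hgm : Measurable g := hwm.ennreal_ofReal
  have hfI : ∀ (x : X) (r : ℝ), 0 < r →
      ∫⁻ y in ball x r, f y ∂μ = ENNReal.ofReal (∫ y in ball x r, s y ∂μ) := fun x r hr =>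
    (ofReal_integral_eq_lintegral_ofReal (hsloc x r hr) (ae_of_all _ fun y => (hs0 y).le)).symm
  have hgI : ∀ (x : X) (r : ℝ), 0 < r →
      ∫⁻ y in ball x r, g y ∂μ = ENNReal.ofReal (∫ y in ball x r, w y ∂μ) := fun x r hr =>
    (ofReal_integral_eq_lintegral_ofReal (hwloc x r hr) (ae_of_all _ fun y => (hw0 y).le)).symm
  have hgpos : ∀ (h : X → ℝ≥0∞), Measurable h → (∀ y, h y ≠ 0) → ∀ (x : X) (r : ℝ), 0 < r →
      ∫⁻ y in ball x r, h y ∂μ ≠ 0 := by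
    intro h hm h0 x r hr hz
    rw [lintegral_eq_zero_iff hm] at hz
    have : ∀ᵐ y ∂μ.restrict (ball x r), False := by
      filter_upwards [hz] with y hy using h0 y hy
    rw [ae_iff] at this
    simp at this
    exact hpos x r hr (by simpa using this)
  have hνapp : ∀ F, MeasurableSet F → μ.withDensity f F = ∫⁻ y in F, f y ∂μ := fun F hF =>
    withDensity_apply _ hF
  have hf0 : ∀ y, f y ≠ 0 := fun y => by simpa [hf] using hs0 y
  have hg0 : ∀ y, g y ≠ 0 := fun y => by simpa [hg] using hw0 y
  have hm0 : ∀ (x : X) (r : ℝ), 0 < r → 0 < μ.real (ball x r) := fun x r hr =>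
    ENNReal.toReal_pos (hpos x r hr) (hfin x r hr)
  have hJ0 : ∀ (x : X) (r : ℝ), 0 ≤ ∫ y in ball x r, s y ∂μ := fun x r =>
    integral_nonneg fun y => (hs0 y).le
  have hI0 : ∀ (x : X) (r : ℝ), 0 ≤ ∫ y in ball x r, w y ∂μ := fun x r =>
    integral_nonneg fun y => (hw0 y).le
  have hAr : ∀ (x : X) (r : ℝ), 0 < r →
      (∫ y in ball x r, w y ∂μ) / μ.real (ball x r) *
        ((∫ y in ball x r, s y ∂μ) / μ.real (ball x r)) ^ (p - 1) ≤ c_w := by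
    intro x r hr
    have := (hw x r hr).2
    rw [setAverage_eq, setAverage_eq] at this
    simp only [smul_eq_mul] at this
    rwa [div_eq_inv_mul, div_eq_inv_mul]
  have hAE : ∀ (x : X) (r : ℝ), 0 < r →
      (∫⁻ y in ball x r, g y ∂μ) * (∫⁻ y in ball x r, f y ∂μ) ^ (p - 1) ≤
        c_w.toNNReal * μ (ball x r) ^ p := by
    intro x r hr
    rw [hgI x r hr, hfI x r hr, ← ENNReal.ofReal_toReal (hfin x r hr),
      ENNReal.ofReal_rpow_of_nonneg (hJ0 x r) hp1.le,
      ENNReal.ofReal_rpow_of_nonneg ENNReal.toReal_nonneg hp0.le,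
      ← ENNReal.ofReal_mul (hI0 x r)]
    change _ ≤ ENNReal.ofReal c_w * _
    rw [← ENNReal.ofReal_mul hcw.le]
    refine ENNReal.ofReal_le_ofReal ?_
    have h1 := hAr x r hr
    have hm := hm0 x r hr
    change _ ≤ c_w * (μ.real (ball x r)) ^ p
    rw [Real.div_rpow (hJ0 x r) hm.le, div_mul_div_comm, div_le_iff₀ (by positivity)] at h1
    refine h1.trans (le_of_eq ?_)
    congr 1
    nth_rewrite 1 [← Real.rpow_one (μ.real (ball x r))]
    rw [← Real.rpow_add hm]
    congr 1; ring
  have hfg : ∀ y, f y ^ ((p - 1) / p) * g y ^ (1 / p) = 1 := by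
    intro y
    simp only [hf, hg, hs]
    rw [ENNReal.ofReal_rpow_of_pos (Real.rpow_pos_of_pos (hw0 y) _),
      ENNReal.ofReal_rpow_of_pos (hw0 y), ← Real.rpow_mul (hw0 y).le,
      ← ENNReal.ofReal_mul (Real.rpow_nonneg (hw0 y).le _), ← Real.rpow_add (hw0 y), hexp]
    have : -(1 / (p - 1)) * ((p - 1) / p) + 1 / p = 0 := by field_simp; ring
    rw [this]; simp
  obtain ⟨ε, hε, C, hC⟩ := rev_holder μ hpos hfin c hc hdb f hfm (fun y => ENNReal.ofReal_ne_top)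
    (fun x r hr => by rw [hνapp _ measurableSet_ball]; exact hgpos f hfm hf0 x r hr)
    (fun x r hr => by rw [hνapp _ measurableSet_ball, hfI x r hr]; exact ENNReal.ofReal_ne_top)
    (fun M => ⟨(c_w.toNNReal * M ^ p) ^ (1 / (p - 1)), fun x r hr F hF hFm hB => by
      rw [hνapp _ measurableSet_ball, hνapp _ hFm]
      exact holder_H μ f g hfm hgm p hp hfg _ M _ F (hgpos g hgm hg0 x r hr)
        (by rw [hgI x r hr]; exact ENNReal.ofReal_ne_top) (hAE x r hr) hF hB⟩)
  have hq0 : 0 < (p - 1) / (1 + ε) := by positivity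
  refine ⟨1 + (p - 1) / (1 + ε), by linarith, ?_,
    c * (C * c) ^ ((p - 1) / (1 + ε)) * c_w + 1, by positivity, ?_⟩
  · have : (p - 1) / (1 + ε) < p - 1 := div_lt_self hp1 (by linarith)
    linarith
  intro x r hr
  have h2r : 0 < 2 * r := by positivity
  have hexp1 : ∀ y, w y ^ (1 - (1 + (p - 1) / (1 + ε)) / (1 + (p - 1) / (1 + ε) - 1)) =
      s y ^ (1 + ε) := by
    intro y
    simp only [hs]
    rw [← Real.rpow_mul (hw0 y).le, hexp]
    congr 1
    rw [exp_id _ (by rw [add_sub_cancel_left]; exact hq0.ne'), add_sub_cancel_left, one_div_div]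
    ring
  simp only [hexp1]
  rw [show 1 + (p - 1) / (1 + ε) - 1 = (p - 1) / (1 + ε) by ring]
  have hfr : ∀ y, ENNReal.ofReal (s y ^ (1 + ε)) = f y ^ (1 + ε) := fun y =>
    (ENNReal.ofReal_rpow_of_nonneg (hs0 y).le (by positivity)).symm
  have hCx := hC x r hr
  rw [hνapp _ measurableSet_ball, hfI x _ h2r, ← ENNReal.ofReal_toReal (hfin x _ h2r)] at hCx
  change _ ≤ (C : ℝ≥0∞) * (_ / ENNReal.ofReal (μ.real (ball x (2 * r)))) ^ ε * _ at hCx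
  rw [← ENNReal.ofReal_div_of_pos (hm0 x _ h2r), ENNReal.ofReal_rpow_of_nonneg
    (div_nonneg (hJ0 x _) (hm0 x _ h2r).le) hε.le, ← ENNReal.ofReal_coe_nnreal,
    ← ENNReal.ofReal_mul C.coe_nonneg, ← ENNReal.ofReal_mul (mul_nonneg C.coe_nonneg
      (Real.rpow_nonneg (div_nonneg (hJ0 x _) (hm0 x _ h2r).le) _))] at hCx
  have hs_int : IntegrableOn (fun y => s y ^ (1 + ε)) (ball x r) μ := by
    refine ⟨(hsm.pow_const _).aestronglyMeasurable, ?_⟩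
    rw [hasFiniteIntegral_iff_ofReal (ae_of_all _ fun y => Real.rpow_nonneg (hs0 y).le _)]
    simp only [hfr]
    exact hCx.trans_lt ENNReal.ofReal_lt_top
  refine ⟨hs_int, ?_⟩
  have hQ : ∫ y in ball x r, s y ^ (1 + ε) ∂μ ≤ C * ((∫ y in ball x (2 * r), s y ∂μ) /
      μ.real (ball x (2 * r))) ^ ε * ∫ y in ball x (2 * r), s y ∂μ := by
    simp only [← hfr] at hCx
    rw [← ofReal_integral_eq_lintegral_ofReal hs_int
      (ae_of_all _ fun y => Real.rpow_nonneg (hs0 y).le _)] at hCx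
    refine (ENNReal.ofReal_le_ofReal_iff ?_).1 hCx
    exact mul_nonneg (mul_nonneg C.coe_nonneg
      (Real.rpow_nonneg (div_nonneg (hJ0 x _) (hm0 x _ h2r).le) _)) (hJ0 x _)
  have hmm : μ.real (ball x (2 * r)) ≤ c * μ.real (ball x r) := by
    have := ENNReal.toReal_mono (ENNReal.mul_ne_top ENNReal.coe_ne_top (hfin x r hr)) (hdb x r hr)
    rwa [ENNReal.toReal_mul] at this
  have hII : ∫ y in ball x r, w y ∂μ ≤ ∫ y in ball x (2 * r), w y ∂μ :=
    setIntegral_mono_set (hwloc x _ h2r) (ae_of_all _ fun y => (hw0 y).le)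
      (LE.le.eventuallyLE (ball_subset_ball (by linarith)))
  have := final_real p ε c C c_w _ _ _ _ _ _ hp hε (by exact_mod_cast hc) C.coe_nonneg
    (hm0 x r hr) (hm0 x _ h2r) (hI0 x r) (hJ0 x (2 * r))
    (integral_nonneg fun y => Real.rpow_nonneg (hs0 y).le _) hmm hII (hAr x _ h2r) hQ
  rw [setAverage_eq, setAverage_eq]
  simp only [smul_eq_mul]
  rw [div_eq_inv_mul, div_eq_inv_mul (∫ y in ball x r, s y ^ (1 + ε) ∂μ)] at this
  linarith

end ApAux


/-- **Corollary 4.3 (open-endedness of the `A_p` condition).** Let `1 < p < ∞` and let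
`w ∈ A_p` in a doubling metric measure space. Then there exists `p₁` with `1 < p₁ < p`
such that `w ∈ A_{p₁}` (with some constant `c₁`). -/
theorem muckenhoupt_open_ended {X : Type*} [MetricSpace X] [MeasurableSpace X]
    [BorelSpace X] (μ : Measure X)
    (hopen : ∀ U : Set X, IsOpen U → U.Nonempty → 0 < μ U)
    (hbdd : ∀ s : Set X, Bornology.IsBounded s → μ s < ⊤)
    (c_d : ℝ≥0) (hdb : IsDoublingMeasure μ c_d)
    (p c_w : ℝ) (hp : 1 < p) (hcw : 0 < c_w)
    (w : X → ℝ) (hw0 : ∀ x, 0 ≤ w x)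
    (hwloc : ∀ (x : X) (r : ℝ), 0 < r → IntegrableOn w (ball x r) μ)
    (hwpos : (∀ᵐ x ∂μ, 0 < w x) ∨ (∀ᵐ x ∂μ, w x = 0))
    (hw : IsAp μ p c_w w) :
    ∃ p₁ : ℝ, 1 < p₁ ∧ p₁ < p ∧ ∃ c₁ : ℝ, 0 < c₁ ∧ IsAp μ p₁ c₁ w := by

  have := ApAux.sigmaFinite_of_bdd μ hbdd
  rcases hwpos with hpos | hzero
  · have hdb' : IsDoublingMeasure μ (max 1 c_d) := fun x r hr =>
      (hdb x r hr).trans (by gcongr; exact le_max_right _ _)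
    have hae : AEMeasurable w μ := by
      rcases isEmpty_or_nonempty X with h | ⟨⟨x0⟩⟩
      · exact (measurable_of_empty w).aemeasurable
      · have h1 : AEMeasurable w (μ.restrict (⋃ n : ℕ, ball x0 (n + 1))) := by
          rw [aemeasurable_iUnion_iff]
          exact fun n => (hwloc x0 (n + 1) (by positivity)).aemeasurable
        have h2 : (⋃ n : ℕ, ball x0 ((n : ℝ) + 1)) = Set.univ := by
          refine Set.eq_univ_of_forall fun y => ?_
          obtain ⟨n, hn⟩ := exists_nat_gt (dist y x0)
          exact Set.mem_iUnion.2 ⟨n, by rw [mem_ball]; linarith⟩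
        rwa [h2, Measure.restrict_univ] at h1
    classical
    set v : X → ℝ := fun y => if 0 < hae.mk w y then hae.mk w y else 1 with hv
    have hvm : Measurable v := Measurable.ite
      (measurableSet_lt measurable_const hae.measurable_mk) hae.measurable_mk measurable_const
    have hv0 : ∀ y, 0 < v y := fun y => by
      simp only [hv]; split_ifs with h
      · exact h
      · exact one_pos
    have hwv : w =ᵐ[μ] v := by
      filter_upwards [hae.ae_eq_mk, hpos] with y h1 h2
      simp only [hv]
      rw [if_pos (h1 ▸ h2), h1]
    obtain ⟨p₁, h1, h2, c₁, h3, h4⟩ := ApAux.main_pos μ hopen hbdd (max 1 c_d) (le_max_left _ _)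
      hdb' p c_w hp hcw v hv0 hvm (fun x r hr => (hwloc x r hr).congr (ae_restrict_of_ae hwv))
      (ApAux.isAp_congr μ p c_w w v hwv hw)
    exact ⟨p₁, h1, h2, c₁, h3, ApAux.isAp_congr μ p₁ c₁ v w hwv.symm h4⟩
  · have h1 : 1 < (1 + p) / 2 := by linarith
    refine ⟨(1 + p) / 2, h1, by linarith, 1, one_pos, ?_⟩
    refine ApAux.isAp_congr μ _ 1 (fun _ => 0) w ?_ ?_
    · filter_upwards [hzero] with y hy using hy.symm
    · intro x r hr
      have h2 : 1 - (1 + p) / 2 / ((1 + p) / 2 - 1) ≠ 0 := by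
        have h3 : (1 + p) / 2 - 1 ≠ 0 := by linarith
        have h4 : 1 - (1 + p) / 2 / ((1 + p) / 2 - 1) = -(1 / ((1 + p) / 2 - 1)) :=
          ApAux.exp_id _ h3
        rw [h4]
        exact neg_ne_zero.2 (one_div_ne_zero h3)
      simp only [Real.zero_rpow h2]
      exact ⟨integrableOn_zero, by simp⟩
end
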